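/- Let μ be a Borel probability measure on ℝ, not a Dirac measure, with m_8(μ) < ∞, m_1(μ) = 0 and m_2(μ) = 1. Then there exist a constant c(μ) > 0 and n₁ = n₁(μ) ∈ ℕ such that for all n ≥ n₁: | Φ(μ_n) − ( 1 + m_3(μ)²/n ) | ≤ c(μ) n^{−6/5}, where Φ(μ_n) = (4π²/3) ∫_ℝ p_n(x)³ dx is the free Fisher information of μ_n (and Φ(w) = 1 for the standard semicircle law w). -/

import Mathlib

open MeasureTheory Complex Filter Set
open scoped Topology

noncomputable section

namespace FreeCLT

def mom (μ : Measure ℝ) (k : ℕ) : ℝ := ∫ u, u ^ k ∂μ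

def cauchy (μ : Measure ℝ) (z : ℂ) : ℂ := ∫ u, (z - (u : ℂ))⁻¹ ∂μ

def recip (μ : Measure ℝ) (z : ℂ) : ℂ := (cauchy μ z)⁻¹

def MemF (F : ℂ → ℂ) : Prop :=
  ∃ ν : Measure ℝ, IsProbabilityMeasure ν ∧ ∀ z : ℂ, 0 < z.im → F z = recip ν z

def Subord (μ : Measure ℝ) (n : ℕ) (Z : ℂ → ℂ) : Prop :=
  MemF Z ∧ ∀ z : ℂ, 0 < z.im →
    z = (n : ℂ) * Z z - ((n : ℂ) - 1) * recip μ (Z z)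

def IsBoxPow (μ : Measure ℝ) (n : ℕ) (Z : ℂ → ℂ) (ν : Measure ℝ) : Prop :=
  Subord μ n Z ∧ IsProbabilityMeasure ν ∧
    ∀ z : ℂ, 0 < z.im → recip ν z = recip μ (Z z)

def rescale (n : ℕ) (ν : Measure ℝ) : Measure ℝ :=
  ν.map (fun x => x / Real.sqrt n)

def HasDensity (ν : Measure ℝ) (p : ℝ → ℝ) : Prop :=
  Continuous p ∧ (∀ x, 0 ≤ p x) ∧
    ν = MeasureTheory.volume.withDensity (fun x => ENNReal.ofReal (p x))

def aQ (μ : Measure ℝ) (n : ℕ) : ℝ := mom μ 3 / Real.sqrt n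
def bQ (μ : Measure ℝ) (n : ℕ) : ℝ := (mom μ 4 - (mom μ 3) ^ 2 - 1) / n
def dQ (μ : Measure ℝ) (n : ℕ) : ℝ := (mom μ 4 - (mom μ 3) ^ 2) / n
def eQ (μ : Measure ℝ) (n : ℕ) : ℝ := (1 - bQ μ n) / Real.sqrt (1 - dQ μ n)

def pw (x : ℝ) : ℝ := (1 / (2 * Real.pi)) * Real.sqrt (max (4 - x ^ 2) 0)

def truncSet (n : ℕ) : Set ℝ := {u : ℝ | |u| ≤ Real.sqrt ((n : ℝ) - 1) / Real.pi}

def Tfun (W : ℕ → ℂ → ℂ) (n : ℕ) (z : ℂ) : ℂ :=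
  W n ((Real.sqrt (n : ℝ) : ℂ) * z) / (Real.sqrt (n : ℝ) : ℂ)

lemma sub_ne {W : ℂ} (hW : 0 < W.im) (u : ℝ) : W - (u : ℂ) ≠ 0 := by
  intro h
  have := congrArg Complex.im h
  simp at this
  linarith

lemma im_le_norm {W : ℂ} (hW : 0 < W.im) (u : ℝ) : W.im ≤ ‖W - (u : ℂ)‖ := by
  have := Complex.abs_im_le_norm (W - (u : ℂ))
  simp at this
  rwa [abs_of_pos hW] at this

lemma X_norm_le {W : ℂ} (hW : 0 < W.im) (u : ℝ) : ‖(W - (u : ℂ))⁻¹‖ ≤ W.im⁻¹ := by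
  rw [norm_inv]
  exact inv_anti₀ hW (im_le_norm hW u)

lemma X_cont {W : ℂ} (hW : 0 < W.im) : Continuous (fun u : ℝ => (W - (u : ℂ))⁻¹) :=
  Continuous.inv₀ (by fun_prop) (sub_ne hW)

lemma pow_int {μ : Measure ℝ} [IsProbabilityMeasure μ] (h8 : Integrable (fun u : ℝ => u ^ 8) μ)
    {k : ℕ} (hk : k ≤ 8) : Integrable (fun u : ℝ => u ^ k) μ := by
  refine Integrable.mono' (h8.add (integrable_const (1:ℝ))) (by fun_prop) (ae_of_all _ fun u => ?_)
  simp only [Pi.add_apply, Real.norm_eq_abs, abs_pow]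
  have e : u ^ 8 = |u| ^ 8 := by rw [← abs_pow, abs_of_nonneg]; positivity
  rw [e]
  rcases le_total |u| 1 with h | h
  · have := pow_le_one₀ (abs_nonneg u) h (n := k)
    have : 0 ≤ |u| ^ 8 := by positivity
    linarith
  · have := pow_le_pow_right₀ h hk
    linarith

lemma powX_int {μ : Measure ℝ} [IsProbabilityMeasure μ] (h8 : Integrable (fun u : ℝ => u ^ 8) μ)
    {k : ℕ} (hk : k ≤ 8) {W : ℂ} (hW : 0 < W.im) :
    Integrable (fun u : ℝ => (u : ℂ) ^ k * (W - (u : ℂ))⁻¹) μ := by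
  have h := ((pow_int h8 hk).norm.mul_const (W.im⁻¹))
  refine Integrable.mono' h ?_ (ae_of_all _ fun u => ?_)
  · exact (Continuous.mul (by fun_prop) (X_cont hW)).aestronglyMeasurable
  · rw [norm_mul, norm_pow, norm_pow, Complex.norm_real]
    exact mul_le_mul_of_nonneg_left (X_norm_le hW u) (by positivity)

lemma X_int (μ : Measure ℝ) [IsProbabilityMeasure μ] {W : ℂ} (hW : 0 < W.im) :
    Integrable (fun u : ℝ => (W - (u : ℂ))⁻¹) μ :=
  Integrable.mono' (integrable_const (W.im⁻¹)) (X_cont hW).aestronglyMeasurable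
    (ae_of_all _ fun u => X_norm_le hW u)

lemma powX2_int {μ : Measure ℝ} [IsProbabilityMeasure μ] (h8 : Integrable (fun u : ℝ => u ^ 8) μ)
    {k : ℕ} (hk : k ≤ 8) {W : ℂ} (hW : 0 < W.im) :
    Integrable (fun u : ℝ => u ^ k * ‖(W - (u : ℂ))⁻¹‖ ^ 2) μ := by
  have h := ((pow_int h8 hk).norm.mul_const (W.im⁻¹ ^ 2))
  refine Integrable.mono' h ?_ (ae_of_all _ fun u => ?_)
  · exact (Continuous.mul (by fun_prop) ((X_cont hW).norm.pow 2)).aestronglyMeasurable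
  · rw [norm_mul, norm_pow, norm_pow, norm_norm]
    exact mul_le_mul_of_nonneg_left (pow_le_pow_left₀ (norm_nonneg _) (X_norm_le hW u) 2)
      (by positivity)

lemma X2_int (μ : Measure ℝ) [IsProbabilityMeasure μ] {W : ℂ} (hW : 0 < W.im) :
    Integrable (fun u : ℝ => ‖(W - (u : ℂ))⁻¹‖ ^ 2) μ :=
  Integrable.mono' (integrable_const (W.im⁻¹ ^ 2)) ((X_cont hW).norm.pow 2).aestronglyMeasurable
    (ae_of_all _ fun u => by
      rw [norm_pow, norm_norm]
      exact pow_le_pow_left₀ (norm_nonneg _) (X_norm_le hW u) 2)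

def E2 (μ : Measure ℝ) (W : ℂ) : ℝ := ∫ u : ℝ, ‖(W - (u : ℂ))⁻¹‖ ^ 2 ∂μ

lemma X_im {W : ℂ} (u : ℝ) : ((W - (u : ℂ))⁻¹).im = - W.im * ‖(W - (u : ℂ))⁻¹‖ ^ 2 := by
  rw [Complex.inv_im, norm_inv, Complex.normSq_eq_norm_sq]
  simp [div_eq_mul_inv]

lemma cauchy_im (μ : Measure ℝ) [IsProbabilityMeasure μ] {W : ℂ} (hW : 0 < W.im) :
    (cauchy μ W).im = - W.im * E2 μ W := by
  have : (cauchy μ W).im = ∫ u : ℝ, ((W - (u : ℂ))⁻¹).im ∂μ := by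
    have := (Complex.imCLM.integral_comp_comm (X_int μ hW))
    simpa [cauchy] using this.symm
  rw [this, E2, ← integral_const_mul]
  exact integral_congr_ae (ae_of_all _ fun u => X_im u)

lemma E2_pos (μ : Measure ℝ) [IsProbabilityMeasure μ] {W : ℂ} (hW : 0 < W.im) : 0 < E2 μ W := by
  rw [E2, integral_pos_iff_support_of_nonneg (fun u => by positivity) (X2_int μ hW)]
  have : Function.support (fun u : ℝ => ‖(W - (u : ℂ))⁻¹‖ ^ 2) = univ := by
    ext u
    simp [sub_ne hW u]
  rw [this]; simp

lemma cauchy_im_neg (μ : Measure ℝ) [IsProbabilityMeasure μ] {W : ℂ} (hW : 0 < W.im) :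
    (cauchy μ W).im < 0 := by
  rw [cauchy_im μ hW]
  have := mul_pos hW (E2_pos μ hW)
  linarith

lemma cauchy_ne (μ : Measure ℝ) [IsProbabilityMeasure μ] {W : ℂ} (hW : 0 < W.im) :
    cauchy μ W ≠ 0 := by
  intro h
  have := cauchy_im_neg μ hW
  simp [h] at this

lemma recip_im_pos (μ : Measure ℝ) [IsProbabilityMeasure μ] {W : ℂ} (hW : 0 < W.im) :
    0 < (recip μ W).im := by
  rw [recip, Complex.inv_im]
  have := cauchy_im_neg μ hW
  have h2 := Complex.normSq_pos.2 (cauchy_ne μ hW)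
  apply div_pos <;> linarith

def JJ (μ : Measure ℝ) (W : ℂ) : ℝ := E2 μ W * ‖recip μ W‖ ^ 2 - 1
def KK (μ : Measure ℝ) (W : ℂ) : ℂ := W - recip μ W

lemma KK_im (μ : Measure ℝ) [IsProbabilityMeasure μ] {W : ℂ} (hW : 0 < W.im) :
    (KK μ W).im = - W.im * JJ μ W := by
  rw [KK, JJ, Complex.sub_im, recip, Complex.inv_im, cauchy_im μ hW, norm_inv,
    Complex.normSq_eq_norm_sq]
  have : ‖cauchy μ W‖ ≠ 0 := by simpa using cauchy_ne μ hW
  field_simp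
  ring

/-- general quadratic expansion -/
lemma quad_exp (μ : Measure ℝ) [IsProbabilityMeasure μ] {W : ℂ} (hW : 0 < W.im) (b c : ℂ) :
    ∫ u : ℝ, ‖b * (W - (u : ℂ))⁻¹ - c‖ ^ 2 ∂μ =
      ‖b‖ ^ 2 * E2 μ W - 2 * (b * cauchy μ W * (starRingEnd ℂ) c).re + ‖c‖ ^ 2 := by
  have h : ∀ u : ℝ, ‖b * (W - (u : ℂ))⁻¹ - c‖ ^ 2 =
      ‖b‖ ^ 2 * ‖(W - (u : ℂ))⁻¹‖ ^ 2 - 2 * (b * (starRingEnd ℂ) c * (W - (u : ℂ))⁻¹).re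
        + ‖c‖ ^ 2 := by
    intro u
    generalize (W - (u : ℂ))⁻¹ = X
    simp only [← Complex.normSq_eq_norm_sq, Complex.normSq_apply]
    simp
    ring
  have hre : ∫ u : ℝ, (b * (starRingEnd ℂ) c * (W - (u : ℂ))⁻¹).re ∂μ
      = (b * (starRingEnd ℂ) c * cauchy μ W).re := by
    have := (Complex.reCLM.integral_comp_comm ((X_int μ hW).const_mul (b * (starRingEnd ℂ) c)))
    rw [integral_const_mul] at this
    simpa [cauchy] using this
  have i1 := (X2_int μ hW).const_mul (‖b‖ ^ 2)
  have i2 : Integrable (fun u : ℝ => 2 * (b * (starRingEnd ℂ) c * (W - (u : ℂ))⁻¹).re) μ :=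
    (((X_int μ hW).const_mul (b * (starRingEnd ℂ) c)).re).const_mul 2
  have i3 : Integrable (fun u : ℝ => ‖b‖ ^ 2 * ‖(W - (u : ℂ))⁻¹‖ ^ 2 -
    2 * (b * (starRingEnd ℂ) c * (W - (u : ℂ))⁻¹).re) μ := i1.sub i2
  simp_rw [h]
  rw [integral_add i3 (integrable_const _), integral_sub i1 i2, integral_const_mul,
    integral_const_mul, hre]
  simp only [E2, integral_const, probReal_univ, smul_eq_mul, one_mul]
  congr 3
  ring_nf

lemma recip_mul (μ : Measure ℝ) [IsProbabilityMeasure μ] {W : ℂ} (hW : 0 < W.im) :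
    recip μ W * cauchy μ W = 1 := inv_mul_cancel₀ (cauchy_ne μ hW)

/-- J as integral -/
lemma JJ_eq (μ : Measure ℝ) [IsProbabilityMeasure μ] {W : ℂ} (hW : 0 < W.im) :
    JJ μ W = ∫ u : ℝ, ‖recip μ W * (W - (u : ℂ))⁻¹ - 1‖ ^ 2 ∂μ := by
  rw [quad_exp μ hW, recip_mul μ hW, JJ]
  simp; ring

lemma JJ_nonneg (μ : Measure ℝ) [IsProbabilityMeasure μ] {W : ℂ} (hW : 0 < W.im) :
    0 ≤ JJ μ W := by
  rw [JJ_eq μ hW]; exact integral_nonneg fun u => by positivity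

lemma JJ_int (μ : Measure ℝ) [IsProbabilityMeasure μ] {W : ℂ} (hW : 0 < W.im) :
    Integrable (fun u : ℝ => ‖recip μ W * (W - (u : ℂ))⁻¹ - 1‖ ^ 2) μ := by
  have hc : Continuous (fun u : ℝ => ‖recip μ W * (W - (u : ℂ))⁻¹ - 1‖ ^ 2) := by
    have := X_cont hW
    fun_prop
  refine Integrable.mono' (integrable_const ((‖recip μ W‖ * W.im⁻¹ + 1) ^ 2))
    hc.aestronglyMeasurable (ae_of_all _ fun u => ?_)
  rw [norm_pow, norm_norm]
  refine pow_le_pow_left₀ (norm_nonneg _) ?_ 2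
  refine (norm_sub_le _ _).trans ?_
  rw [norm_mul, norm_one]
  have := mul_le_mul_of_nonneg_left (X_norm_le hW u) (norm_nonneg (recip μ W))
  linarith

lemma pow_step {μ : Measure ℝ} [IsProbabilityMeasure μ] (h8 : Integrable (fun u : ℝ => u ^ 8) μ)
    {k : ℕ} (hk : k + 1 ≤ 8) {W : ℂ} (hW : 0 < W.im) :
    W * ∫ u : ℝ, (u : ℂ) ^ k * (W - (u : ℂ))⁻¹ ∂μ =
      (mom μ k : ℂ) + ∫ u : ℝ, (u : ℂ) ^ (k + 1) * (W - (u : ℂ))⁻¹ ∂μ := by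
  have hm : (mom μ k : ℂ) = ∫ u : ℝ, (u : ℂ) ^ k ∂μ := by
    rw [mom, ← integral_complex_ofReal]
    simp
  have i0 : Integrable (fun u : ℝ => (u : ℂ) ^ k) μ := by
    have := (pow_int h8 (k := k) (by omega)).ofReal (𝕜 := ℂ)
    simpa using this
  rw [hm, ← integral_const_mul, ← integral_add i0 (powX_int h8 hk hW)]
  refine integral_congr_ae (ae_of_all _ fun u => ?_)
  have := sub_ne hW u
  simp only
  field_simp
  ring

/-- WE = 1 + ∫ u X -/
lemma KK_eq {μ : Measure ℝ} [IsProbabilityMeasure μ] (h8 : Integrable (fun u : ℝ => u ^ 8) μ)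
    {W : ℂ} (hW : 0 < W.im) :
    KK μ W = recip μ W * ∫ u : ℝ, (u : ℂ) * (W - (u : ℂ))⁻¹ ∂μ := by
  have := pow_step h8 (k := 0) (by norm_num) hW
  simp [mom] at this
  have h2 : ∫ u : ℝ, (u : ℂ) * (W - (u : ℂ))⁻¹ ∂μ = W * cauchy μ W - 1 := by
    rw [cauchy, this]; ring
  rw [h2, KK, mul_sub, mul_left_comm, recip_mul μ hW]
  ring

lemma KK_sq_le {μ : Measure ℝ} [IsProbabilityMeasure μ] (h8 : Integrable (fun u : ℝ => u ^ 8) μ)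
    (h1 : mom μ 1 = 0) (h2 : mom μ 2 = 1) {W : ℂ} (hW : 0 < W.im) :
    ‖KK μ W‖ ^ 2 ≤ JJ μ W := by
  set F := recip μ W
  have i1 : Integrable (fun u : ℝ => (u : ℂ) * (F * (W - (u : ℂ))⁻¹)) μ := by
    have := (powX_int h8 (k := 1) (by norm_num) hW).const_mul F
    refine this.congr (ae_of_all _ fun u => ?_)
    simp only; ring
  have i0 : Integrable (fun u : ℝ => (u : ℂ)) μ := by
    have := (pow_int h8 (k := 1) (by norm_num)).ofReal (𝕜 := ℂ)
    simpa using this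
  have e : KK μ W = ∫ u : ℝ, (u : ℂ) * (F * (W - (u : ℂ))⁻¹ - 1) ∂μ := by
    have : ∀ u : ℝ, (u : ℂ) * (F * (W - (u : ℂ))⁻¹ - 1)
      = (u : ℂ) * (F * (W - (u : ℂ))⁻¹) - u := by intro u; ring
    simp_rw [this]
    rw [integral_sub i1 i0, KK_eq h8 hW, ← integral_const_mul]
    have hz : ∫ u : ℝ, (u : ℂ) ∂μ = 0 := by
      rw [integral_complex_ofReal]
      simp [mom] at h1
      simp [h1]
    rw [hz, sub_zero]
    refine integral_congr_ae (ae_of_all _ fun u => ?_)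
    simp only; ring
  have key : ∀ t : ℝ, 0 < t → 2 * ‖KK μ W‖ ≤ t + JJ μ W / t := by
    intro t ht
    have hn : ‖KK μ W‖ ≤ ∫ u : ℝ, (t / 2 * u ^ 2 +
        (1 / (2 * t)) * ‖F * (W - (u : ℂ))⁻¹ - 1‖ ^ 2) ∂μ := by
      rw [e]
      refine norm_integral_le_of_norm_le
        (((pow_int h8 (k := 2) (by norm_num)).const_mul _).add ((JJ_int μ hW).const_mul _))
        (ae_of_all _ fun u => ?_)
      rw [norm_mul, Complex.norm_real, Real.norm_eq_abs, ← sq_abs u]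
      change _ ≤ t / 2 * |u| ^ 2 + (1 / (2 * t)) * ‖F * (W - (u : ℂ))⁻¹ - 1‖ ^ 2
      generalize ‖F * (W - (u : ℂ))⁻¹ - 1‖ = b
      generalize |u| = a
      have : t / 2 * a ^ 2 + (1 / (2 * t)) * b ^ 2 - a * b = (t * a - b) ^ 2 / (2 * t) := by
        field_simp; ring
      have h : 0 ≤ (t * a - b) ^ 2 / (2 * t) := by positivity
      linarith
    rw [integral_add ((pow_int h8 (k := 2) (by norm_num)).const_mul _)
      ((JJ_int μ hW).const_mul _), integral_const_mul, integral_const_mul, ← JJ_eq μ hW] at hn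
    have h2' : ∫ u : ℝ, u ^ 2 ∂μ = 1 := h2
    rw [h2'] at hn
    calc 2 * ‖KK μ W‖ ≤ 2 * (t / 2 * 1 + 1 / (2 * t) * JJ μ W) := by linarith
      _ = _ := by field_simp
  rcases (norm_nonneg (KK μ W)).eq_or_lt with h | h
  · rw [← h]; simpa using JJ_nonneg μ hW
  · have := key _ h
    have h3 : ‖KK μ W‖ ≤ JJ μ W / ‖KK μ W‖ := by linarith
    rw [le_div_iff₀ h] at h3
    nlinarith

lemma JJ_lower {μ : Measure ℝ} [IsProbabilityMeasure μ] (h8 : Integrable (fun u : ℝ => u ^ 8) μ)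
    (h1 : mom μ 1 = 0) (h2 : mom μ 2 = 1) {W : ℂ} (hW : 0 < W.im)
    (hb : ‖KK μ W‖ ≤ (∫ u : ℝ, |u| ∂μ) / 2) :
    ((∫ u : ℝ, |u| ∂μ) / 2) ^ 2 ≤ JJ μ W * (‖W‖ ^ 2 + 1) := by
  set b := ∫ u : ℝ, |u| ∂μ
  have ia : Integrable (fun u : ℝ => |u|) μ := by
    have := (pow_int h8 (k := 1) (by norm_num)).norm
    simpa using this
  have i1 : Integrable (fun u : ℝ => u) μ := by
    have := (pow_int h8 (k := 1) (by norm_num))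
    simpa using this
  have i2 := (pow_int h8 (k := 2) (by norm_num))
  have hW2 : ∀ u : ℝ, ‖W - (u : ℂ)‖ ^ 2 = ‖W‖ ^ 2 - 2 * W.re * u + u ^ 2 := by
    intro u
    simp only [← Complex.normSq_eq_norm_sq, Complex.normSq_apply]
    simp; ring
  have key : ∀ t : ℝ, 0 < t → 2 * t * (b - ‖KK μ W‖) - t ^ 2 * (‖W‖ ^ 2 + 1) ≤ JJ μ W := by
    intro t ht
    have hle : ∫ u : ℝ, ((2 * t * |u| - 2 * t * ‖KK μ W‖) -
        (t ^ 2 * ‖W‖ ^ 2 - t ^ 2 * 2 * W.re * u + t ^ 2 * u ^ 2)) ∂μ ≤ JJ μ W := by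
      rw [JJ_eq μ hW]
      refine integral_mono (((ia.const_mul _).sub (integrable_const _)).sub
        (((integrable_const _).sub (i1.const_mul _)).add (i2.const_mul _))) (JJ_int μ hW)
        fun u => ?_
      have hne := sub_ne hW u
      have e : recip μ W * (W - (u : ℂ))⁻¹ - 1 = ((u : ℂ) - KK μ W) * (W - (u : ℂ))⁻¹ := by
        rw [KK]; field_simp; ring
      simp only
      rw [e, norm_mul, norm_inv]
      have hp : 0 < ‖W - (u : ℂ)‖ := norm_pos_iff.2 hne
      have hq := hW2 u
      set h := ‖W - (u : ℂ)‖
      have h3 : |u| - ‖KK μ W‖ ≤ ‖(u : ℂ) - KK μ W‖ := by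
        have := norm_sub_norm_le (u : ℂ) (KK μ W)
        simpa using this
      set f := ‖(u : ℂ) - KK μ W‖
      have h4 : 2 * t * f - t ^ 2 * h ^ 2 ≤ (f * h⁻¹) ^ 2 := by
        have : f = (f * h⁻¹) * h := by field_simp
        nlinarith [sq_nonneg (f * h⁻¹ - t * h)]
      nlinarith
    have j1 : Integrable (fun u : ℝ => 2 * t * |u| - 2 * t * ‖KK μ W‖) μ :=
      (ia.const_mul _).sub (integrable_const _)
    have j2 : Integrable (fun u : ℝ => t ^ 2 * ‖W‖ ^ 2 - t ^ 2 * 2 * W.re * u) μ :=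
      (integrable_const _).sub (i1.const_mul _)
    have j3 : Integrable (fun u : ℝ => t ^ 2 * ‖W‖ ^ 2 - t ^ 2 * 2 * W.re * u + t ^ 2 * u ^ 2) μ :=
      j2.add (i2.const_mul _)
    rw [integral_sub j1 j3,
      integral_sub (ia.const_mul _) (integrable_const _),
      integral_add j2 (i2.const_mul _),
      integral_sub (integrable_const _) (i1.const_mul _)] at hle
    simp only [integral_const_mul] at hle
    have h1' : ∫ u : ℝ, u ∂μ = 0 := by simpa [mom] using h1
    have h2' : ∫ u : ℝ, u ^ 2 ∂μ = 1 := h2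
    have h1'' : ∫ u : ℝ, t ^ 2 * 2 * W.re * u ∂μ = 0 := by
      have := integral_const_mul (μ := μ) (t ^ 2 * 2 * W.re) (fun u : ℝ => u)
      rw [this, h1', mul_zero]
    rw [h1'', h2'] at hle
    simp only [integral_const, probReal_univ, smul_eq_mul, one_mul] at hle
    linarith
  rcases (norm_nonneg (KK μ W)).trans hb |>.eq_or_lt with h | h
  · rw [← h]
    have := JJ_nonneg μ hW
    nlinarith [sq_nonneg ‖W‖, mul_nonneg this (sq_nonneg ‖W‖)]
  · have hpos : 0 < ‖W‖ ^ 2 + 1 := by positivity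
    have := key ((b / 2) / (‖W‖ ^ 2 + 1)) (by positivity)
    have h3 : 2 * ((b / 2) / (‖W‖ ^ 2 + 1)) * (b / 2) - ((b / 2) / (‖W‖ ^ 2 + 1)) ^ 2 * (‖W‖ ^ 2 + 1)
        ≤ JJ μ W := by
      refine le_trans ?_ this
      have : 0 ≤ 2 * ((b / 2) / (‖W‖ ^ 2 + 1)) := by positivity
      have := mul_le_mul_of_nonneg_left (show b / 2 ≤ b - ‖KK μ W‖ by linarith) this
      linarith
    have h4 : 2 * ((b / 2) / (‖W‖ ^ 2 + 1)) * (b / 2) - ((b / 2) / (‖W‖ ^ 2 + 1)) ^ 2 * (‖W‖ ^ 2 + 1)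
        = (b / 2) ^ 2 / (‖W‖ ^ 2 + 1) := by field_simp; ring
    rw [h4, div_le_iff₀ hpos] at h3
    exact h3

lemma absmom_pos {μ : Measure ℝ} [IsProbabilityMeasure μ] (h8 : Integrable (fun u : ℝ => u ^ 8) μ)
    (h2 : mom μ 2 = 1) : 0 < ∫ u : ℝ, |u| ∂μ := by
  have ia : Integrable (fun u : ℝ => |u|) μ := by
    have := (pow_int h8 (k := 1) (by norm_num)).norm
    simpa using this
  refine lt_of_le_of_ne (integral_nonneg fun u => abs_nonneg u) fun h => ?_
  rw [eq_comm, integral_eq_zero_iff_of_nonneg (fun u => abs_nonneg u) ia] at h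
  have : ∫ u : ℝ, u ^ 2 ∂μ = 0 := by
    rw [integral_eq_zero_of_ae]
    filter_upwards [h] with u hu
    simp at hu
    simp [hu]
  rw [mom, this] at h2
  norm_num at h2

lemma W_norm_pos {W : ℂ} (hW : 0 < W.im) : 0 < ‖W‖ := by
  rw [norm_pos_iff]; rintro rfl; simp at hW

lemma JJ_eq2 {μ : Measure ℝ} [IsProbabilityMeasure μ] {W : ℂ} (hW : 0 < W.im) :
    JJ μ W = ‖recip μ W‖ ^ 2 * (‖W‖⁻¹ ^ 2 * (∫ u : ℝ, u ^ 2 * ‖(W - (u : ℂ))⁻¹‖ ^ 2 ∂μ)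
      - ‖cauchy μ W - W⁻¹‖ ^ 2) := by
  have hW0 : W ≠ 0 := by intro h; simp [h] at hW
  have h1 := quad_exp μ hW 1 W⁻¹
  have h2 : ∫ u : ℝ, ‖1 * (W - (u : ℂ))⁻¹ - W⁻¹‖ ^ 2 ∂μ =
      ‖W‖⁻¹ ^ 2 * (∫ u : ℝ, u ^ 2 * ‖(W - (u : ℂ))⁻¹‖ ^ 2 ∂μ) := by
    rw [← integral_const_mul]
    refine integral_congr_ae (ae_of_all _ fun u => ?_)
    have hne := sub_ne hW u
    have : 1 * (W - (u : ℂ))⁻¹ - W⁻¹ = W⁻¹ * ((u : ℂ) * (W - (u : ℂ))⁻¹) := by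
      field_simp; ring
    simp only
    rw [this, norm_mul, norm_mul, Complex.norm_real, Real.norm_eq_abs, mul_pow, mul_pow, sq_abs,
      norm_inv]
  have h3 : ‖cauchy μ W - W⁻¹‖ ^ 2 = ‖cauchy μ W‖ ^ 2
      - 2 * (cauchy μ W * (starRingEnd ℂ) W⁻¹).re + ‖W⁻¹‖ ^ 2 := by
    generalize W⁻¹ = c
    generalize cauchy μ W = X
    simp only [← Complex.normSq_eq_norm_sq, Complex.normSq_apply]
    simp
    ring
  have h4 : ‖recip μ W‖ ^ 2 * ‖cauchy μ W‖ ^ 2 = 1 := by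
    rw [← mul_pow, ← norm_mul, recip_mul μ hW]; simp
  rw [← h2, h1, h3, JJ]
  simp only [norm_one, one_pow, one_mul]
  linear_combination h4

lemma norm_sub_ge {W : ℂ} {u : ℝ} (hu : |u| ≤ ‖W‖ / 2) : ‖W‖ / 2 ≤ ‖W - (u : ℂ)‖ := by
  have := norm_sub_norm_le W (u : ℂ)
  rw [Complex.norm_real, Real.norm_eq_abs] at this
  linarith

lemma X2_bound {W : ℂ} (hW : 0 < W.im) (u : ℝ) :
    u ^ 2 * ‖(W - (u : ℂ))⁻¹‖ ^ 2 ≤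
      4 / ‖W‖ ^ 2 * u ^ 2 + 64 / (‖W‖ ^ 6 * W.im ^ 2) * u ^ 8 := by
  have hl := W_norm_pos hW
  rcases le_total |u| (‖W‖ / 2) with h | h
  · have h1 : ‖(W - (u : ℂ))⁻¹‖ ≤ 2 / ‖W‖ := by
      rw [norm_inv, ← inv_div]
      exact inv_anti₀ (by positivity) (norm_sub_ge h)
    have h2 : ‖(W - (u : ℂ))⁻¹‖ ^ 2 ≤ 4 / ‖W‖ ^ 2 := by
      refine (pow_le_pow_left₀ (norm_nonneg _) h1 2).trans_eq ?_
      rw [div_pow]; norm_num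
    have h3 := mul_le_mul_of_nonneg_left h2 (sq_nonneg u)
    have : 0 ≤ 64 / (‖W‖ ^ 6 * W.im ^ 2) * u ^ 8 := by positivity
    linarith
  · have h2 : ‖(W - (u : ℂ))⁻¹‖ ^ 2 ≤ 1 / W.im ^ 2 := by
      refine (pow_le_pow_left₀ (norm_nonneg _) (X_norm_le hW u) 2).trans_eq ?_
      simp
    have h3 := mul_le_mul_of_nonneg_left h2 (sq_nonneg u)
    have h4 : ‖W‖ ^ 6 ≤ 64 * u ^ 6 := by
      have := pow_le_pow_left₀ hl.le (show ‖W‖ ≤ 2 * |u| by linarith) 6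
      rw [mul_pow, ← abs_pow, abs_of_nonneg (by positivity : 0 ≤ u ^ 6)] at this
      linarith
    have h5 : u ^ 2 * (1 / W.im ^ 2) ≤ 64 / (‖W‖ ^ 6 * W.im ^ 2) * u ^ 8 := by
      rw [mul_one_div, div_mul_eq_mul_div, div_le_div_iff₀ (by positivity) (by positivity)]
      have := mul_le_mul_of_nonneg_left h4 (show 0 ≤ u ^ 2 * W.im ^ 2 by positivity)
      linarith
    have : 0 ≤ 4 / ‖W‖ ^ 2 * u ^ 2 := by positivity
    linarith

lemma JJ_upper {μ : Measure ℝ} [IsProbabilityMeasure μ] (h8 : Integrable (fun u : ℝ => u ^ 8) μ)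
    (h2 : mom μ 2 = 1) {W : ℂ} (hW : 0 < W.im) :
    JJ μ W ≤ ‖recip μ W‖ ^ 2 * (4 / ‖W‖ ^ 4 + 64 * mom μ 8 / (‖W‖ ^ 8 * W.im ^ 2)) := by
  have hl := W_norm_pos hW
  rw [JJ_eq2 hW]
  refine mul_le_mul_of_nonneg_left ?_ (by positivity)
  have hI : ∫ u : ℝ, u ^ 2 * ‖(W - (u : ℂ))⁻¹‖ ^ 2 ∂μ ≤
      4 / ‖W‖ ^ 2 + 64 / (‖W‖ ^ 6 * W.im ^ 2) * mom μ 8 := by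
    have i2 := (pow_int h8 (k := 2) (by norm_num)).const_mul (4 / ‖W‖ ^ 2)
    have i8 := (pow_int h8 (k := 8) (by norm_num)).const_mul (64 / (‖W‖ ^ 6 * W.im ^ 2))
    have := integral_mono (powX2_int h8 (k := 2) (by norm_num) hW) (i2.add i8) (X2_bound hW)
    simp only [Pi.add_apply] at this
    rw [integral_add i2 i8, integral_const_mul, integral_const_mul] at this
    have h2' : ∫ u : ℝ, u ^ 2 ∂μ = 1 := h2
    rw [h2', mul_one] at this
    exact this
  have := mul_le_mul_of_nonneg_left hI (show 0 ≤ ‖W‖⁻¹ ^ 2 by positivity)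
  have e : ‖W‖⁻¹ ^ 2 * (4 / ‖W‖ ^ 2 + 64 / (‖W‖ ^ 6 * W.im ^ 2) * mom μ 8) =
      4 / ‖W‖ ^ 4 + 64 * mom μ 8 / (‖W‖ ^ 8 * W.im ^ 2) := by field_simp
  have : 0 ≤ ‖cauchy μ W - W⁻¹‖ ^ 2 := by positivity
  linarith

lemma X2_exp {W : ℂ} (hW : 0 < W.im) (u : ℝ) :
    |u ^ 2 * ‖(W - (u : ℂ))⁻¹‖ ^ 2 - (1 / ‖W‖ ^ 2 * u ^ 2 + 2 * W.re / ‖W‖ ^ 4 * u ^ 3)| ≤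
      24 / ‖W‖ ^ 4 * u ^ 4 + 64 / (‖W‖ ^ 6 * W.im ^ 2) * u ^ 8 := by
  have hl := W_norm_pos hW
  have hw : |W.re| ≤ ‖W‖ := Complex.abs_re_le_norm W
  rcases le_total |u| (‖W‖ / 2) with h | h
  · have hne := sub_ne hW u
    have hp : 0 < ‖W - (u : ℂ)‖ := norm_pos_iff.2 hne
    have hh : ‖W - (u : ℂ)‖ ^ 2 = ‖W‖ ^ 2 - 2 * W.re * u + u ^ 2 := by
      simp only [← Complex.normSq_eq_norm_sq, Complex.normSq_apply]
      simp; ring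
    have hge := pow_le_pow_left₀ (by positivity) (norm_sub_ge h) 2
    rw [norm_inv, inv_pow]
    have hp2 : 0 < ‖W - (u : ℂ)‖ ^ 2 := by positivity
    set h2 := ‖W - (u : ℂ)‖ ^ 2
    set l := ‖W‖
    have e : u ^ 2 * h2⁻¹ - (1 / l ^ 2 * u ^ 2 + 2 * W.re / l ^ 4 * u ^ 3) =
        u ^ 4 * (-l ^ 2 + 4 * W.re ^ 2 - 2 * u * W.re) / (h2 * l ^ 4) := by
      field_simp
      rw [hh]; ring
    rw [e, abs_div, abs_mul, abs_of_nonneg (show 0 ≤ u ^ 4 by positivity),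
      abs_of_pos (show 0 < h2 * l ^ 4 by positivity)]
    have hn : |-l ^ 2 + 4 * W.re ^ 2 - 2 * u * W.re| ≤ 6 * l ^ 2 := by
      have a1 : W.re ^ 2 ≤ l ^ 2 := by rw [← sq_abs]; exact pow_le_pow_left₀ (abs_nonneg _) hw 2
      have a2 : |u * W.re| ≤ l / 2 * l := by
        rw [abs_mul]; exact mul_le_mul h hw (abs_nonneg _) (by positivity)
      have a3 := abs_le.1 a2
      rw [abs_le]
      constructor <;> nlinarith
    have h5 : u ^ 4 * |-l ^ 2 + 4 * W.re ^ 2 - 2 * u * W.re| / (h2 * l ^ 4) ≤ 24 / l ^ 4 * u ^ 4 := by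
      rw [div_mul_eq_mul_div, div_le_div_iff₀ (by positivity) (by positivity)]
      have b1 : u ^ 4 * |-l ^ 2 + 4 * W.re ^ 2 - 2 * u * W.re| ≤ u ^ 4 * (24 * h2) :=
        mul_le_mul_of_nonneg_left (by nlinarith) (by positivity)
      have := mul_le_mul_of_nonneg_right b1 (show 0 ≤ l ^ 4 by positivity)
      linarith
    have : 0 ≤ 64 / (l ^ 6 * W.im ^ 2) * u ^ 8 := by positivity
    linarith
  · have hA := X2_bound hW u
    have h0 : 0 ≤ u ^ 2 * ‖(W - (u : ℂ))⁻¹‖ ^ 2 := by positivity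
    have hlu : ‖W‖ ≤ 2 * |u| := by linarith
    have h4 : ‖W‖ ^ 2 ≤ 4 * u ^ 2 := by
      have := pow_le_pow_left₀ hl.le hlu 2
      rw [mul_pow, sq_abs] at this
      linarith
    have h5 : 1 / ‖W‖ ^ 2 * u ^ 2 ≤ 4 / ‖W‖ ^ 4 * u ^ 4 := by
      rw [div_mul_eq_mul_div, div_mul_eq_mul_div, div_le_div_iff₀ (by positivity) (by positivity)]
      have := mul_le_mul_of_nonneg_left h4 (show 0 ≤ u ^ 2 * ‖W‖ ^ 2 by positivity)
      nlinarith
    have h6 : |2 * W.re / ‖W‖ ^ 4 * u ^ 3| ≤ 4 / ‖W‖ ^ 4 * u ^ 4 := by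
      rw [div_mul_eq_mul_div, div_mul_eq_mul_div, abs_div,
        abs_of_pos (show 0 < ‖W‖ ^ 4 by positivity)]
      refine div_le_div_of_nonneg_right ?_ (by positivity)
      have e4 : u ^ 4 = |u| * |u| ^ 3 := by
        have e5 : |u| * |u| ^ 3 = |u ^ 4| := by rw [abs_pow]; ring
        rw [e5, abs_of_nonneg (show 0 ≤ u ^ 4 by positivity)]
      rw [abs_mul, abs_mul, abs_pow, e4]
      have := mul_le_mul_of_nonneg_right (hw.trans hlu) (show 0 ≤ |u| ^ 3 by positivity)
      norm_num
      linarith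
    have h7 := abs_le.1 h6
    have h8 : 4 / ‖W‖ ^ 2 * u ^ 2 = 4 * (1 / ‖W‖ ^ 2 * u ^ 2) := by ring
    have h9 : 24 / ‖W‖ ^ 4 * u ^ 4 = 6 * (4 / ‖W‖ ^ 4 * u ^ 4) := by ring
    have h10 : 0 ≤ 1 / ‖W‖ ^ 2 * u ^ 2 := by positivity
    have h11 : 0 ≤ 64 / (‖W‖ ^ 6 * W.im ^ 2) * u ^ 8 := by positivity
    rw [abs_le, h9]
    rw [h8] at hA
    constructor <;> linarith [h7.1, h7.2]

lemma I2_exp {μ : Measure ℝ} [IsProbabilityMeasure μ] (h8 : Integrable (fun u : ℝ => u ^ 8) μ)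
    (h2 : mom μ 2 = 1) {W : ℂ} (hW : 0 < W.im) :
    |(∫ u : ℝ, u ^ 2 * ‖(W - (u : ℂ))⁻¹‖ ^ 2 ∂μ) -
        (1 / ‖W‖ ^ 2 + 2 * W.re / ‖W‖ ^ 4 * mom μ 3)| ≤
      24 / ‖W‖ ^ 4 * mom μ 4 + 64 / (‖W‖ ^ 6 * W.im ^ 2) * mom μ 8 := by
  have i2 := (pow_int h8 (k := 2) (by norm_num)).const_mul (1 / ‖W‖ ^ 2)
  have i3 := (pow_int h8 (k := 3) (by norm_num)).const_mul (2 * W.re / ‖W‖ ^ 4)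
  have i4 := (pow_int h8 (k := 4) (by norm_num)).const_mul (24 / ‖W‖ ^ 4)
  have i8 := (pow_int h8 (k := 8) (by norm_num)).const_mul (64 / (‖W‖ ^ 6 * W.im ^ 2))
  have i23 : Integrable (fun u : ℝ => 1 / ‖W‖ ^ 2 * u ^ 2 + 2 * W.re / ‖W‖ ^ 4 * u ^ 3) μ :=
    i2.add i3
  have hX := powX2_int h8 (k := 2) (by norm_num) hW
  have h2' : ∫ u : ℝ, u ^ 2 ∂μ = 1 := h2
  have e1 : (∫ u : ℝ, u ^ 2 * ‖(W - (u : ℂ))⁻¹‖ ^ 2 ∂μ) -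
        (1 / ‖W‖ ^ 2 + 2 * W.re / ‖W‖ ^ 4 * mom μ 3) =
      ∫ u : ℝ, (u ^ 2 * ‖(W - (u : ℂ))⁻¹‖ ^ 2 -
        (1 / ‖W‖ ^ 2 * u ^ 2 + 2 * W.re / ‖W‖ ^ 4 * u ^ 3)) ∂μ := by
    rw [integral_sub hX i23, integral_add i2 i3, integral_const_mul, integral_const_mul, h2',
      mul_one, mom]
  have e2 : 24 / ‖W‖ ^ 4 * mom μ 4 + 64 / (‖W‖ ^ 6 * W.im ^ 2) * mom μ 8 =
      ∫ u : ℝ, (24 / ‖W‖ ^ 4 * u ^ 4 + 64 / (‖W‖ ^ 6 * W.im ^ 2) * u ^ 8) ∂μ := by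
    rw [integral_add i4 i8, integral_const_mul, integral_const_mul, mom, mom]
  rw [e1, e2, ← Real.norm_eq_abs]
  exact norm_integral_le_of_norm_le (i4.add i8) (ae_of_all _ fun u => X2_exp hW u)

lemma X4_bound {W : ℂ} (hW : 0 < W.im) (u : ℝ) :
    ‖(u : ℂ) ^ 4 * (W - (u : ℂ))⁻¹‖ ≤
      2 / ‖W‖ * u ^ 4 + 16 / (‖W‖ ^ 4 * W.im) * u ^ 8 := by
  have hl := W_norm_pos hW
  rw [norm_mul, norm_pow, Complex.norm_real, Real.norm_eq_abs, ← abs_pow,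
    abs_of_nonneg (show 0 ≤ u ^ 4 by positivity)]
  rcases le_total |u| (‖W‖ / 2) with h | h
  · have h1 : ‖(W - (u : ℂ))⁻¹‖ ≤ 2 / ‖W‖ := by
      rw [norm_inv, ← inv_div]
      exact inv_anti₀ (by positivity) (norm_sub_ge h)
    have h3 := mul_le_mul_of_nonneg_left h1 (show 0 ≤ u ^ 4 by positivity)
    have : 0 ≤ 16 / (‖W‖ ^ 4 * W.im) * u ^ 8 := by positivity
    linarith
  · have h3 := mul_le_mul_of_nonneg_left (X_norm_le hW u) (show 0 ≤ u ^ 4 by positivity)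
    have h4 : ‖W‖ ^ 4 ≤ 16 * u ^ 4 := by
      have := pow_le_pow_left₀ hl.le (show ‖W‖ ≤ 2 * |u| by linarith) 4
      rw [mul_pow, ← abs_pow, abs_of_nonneg (by positivity : 0 ≤ u ^ 4)] at this
      linarith
    have h5 : u ^ 4 * W.im⁻¹ ≤ 16 / (‖W‖ ^ 4 * W.im) * u ^ 8 := by
      rw [← div_eq_mul_inv, div_mul_eq_mul_div, div_le_div_iff₀ (by positivity) (by positivity)]
      have := mul_le_mul_of_nonneg_left h4 (show 0 ≤ u ^ 4 * W.im by positivity)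
      linarith
    have : 0 ≤ 2 / ‖W‖ * u ^ 4 := by positivity
    linarith

lemma KK_exp {μ : Measure ℝ} [IsProbabilityMeasure μ] (h8 : Integrable (fun u : ℝ => u ^ 8) μ)
    (h1 : mom μ 1 = 0) (h2 : mom μ 2 = 1) {W : ℂ} (hW : 0 < W.im) :
    ∃ r : ℂ, KK μ W = (W - KK μ W) * (1 / W ^ 2 + mom μ 3 / W ^ 3 + r) ∧
      ‖r‖ ≤ (2 / ‖W‖ * mom μ 4 + 16 / (‖W‖ ^ 4 * W.im) * mom μ 8) / ‖W‖ ^ 3 := by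
  have hW0 : W ≠ 0 := by intro h; simp [h] at hW
  have hl := W_norm_pos hW
  refine ⟨(∫ u : ℝ, (u : ℂ) ^ 4 * (W - (u : ℂ))⁻¹ ∂μ) / W ^ 3, ?_, ?_⟩
  · have s1 := pow_step h8 (k := 1) (by norm_num) hW
    have s2 := pow_step h8 (k := 2) (by norm_num) hW
    have s3 := pow_step h8 (k := 3) (by norm_num) hW
    rw [h1] at s1
    rw [h2] at s2
    norm_num at s1 s2 s3
    have hF : W - KK μ W = recip μ W := by rw [KK]; ring
    rw [hF]
    conv_lhs => rw [KK_eq h8 hW]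
    congr 1
    have e : W ^ 3 * ∫ u : ℝ, (u : ℂ) * (W - (u : ℂ))⁻¹ ∂μ =
      W + mom μ 3 + ∫ u : ℝ, (u : ℂ) ^ 4 * (W - (u : ℂ))⁻¹ ∂μ := by
      linear_combination W ^ 2 * s1 + W * s2 + s3
    generalize (∫ u : ℝ, (u : ℂ) * (W - (u : ℂ))⁻¹ ∂μ) = P at e ⊢
    generalize (∫ u : ℝ, (u : ℂ) ^ 4 * (W - (u : ℂ))⁻¹ ∂μ) = Q at e ⊢
    field_simp
    linear_combination e
  · rw [norm_div, norm_pow]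
    refine div_le_div_of_nonneg_right ?_ (by positivity)
    have i4 := (pow_int h8 (k := 4) (by norm_num)).const_mul (2 / ‖W‖)
    have i8 := (pow_int h8 (k := 8) (by norm_num)).const_mul (16 / (‖W‖ ^ 4 * W.im))
    rw [mom, mom, ← integral_const_mul, ← integral_const_mul, ← integral_add i4 i8]
    exact norm_integral_le_of_norm_le (i4.add i8) (ae_of_all _ fun u => X4_bound hW u)

structure Pt (C c0 a N : ℝ) (z T k G : ℂ) (κ : ℝ) : Prop where
  hT : 0 < T.im
  hG : G ≠ 0
  hG_im : G.im < 0
  hz1 : z = G⁻¹ + k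
  hz2 : z = T + (1 - 1 / (N : ℂ)) * k
  hk : ‖k‖ ≤ 2
  hc : c0 ≤ ‖T‖
  hκ0 : 0 ≤ κ
  hκ2 : κ ≤ 2
  hkim : k.im = - κ * T.im
  hκu : κ ≤ ‖G⁻¹‖ ^ 2 * (4 / ‖T‖ ^ 4 + C / (N ^ 3 * ‖T‖ ^ 8 * T.im ^ 2))
  hke : ‖k - 1 / T - a / T ^ 2‖ ≤ C / N * (1 + 1 / (N ^ 2 * T.im)) / ‖T‖ ^ 2
  hκe : |κ - (1 / ‖T‖ ^ 2 * (1 + 2 * a * T.re / ‖T‖ ^ 2))| ≤ C * (1 / N + 1 / (N ^ 3 * T.im ^ 2))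

lemma cauchy_rescale {n : ℕ} (hn : 1 ≤ n) (ν : Measure ℝ) [IsProbabilityMeasure ν] {z : ℂ}
    (hz : 0 < z.im) :
    cauchy (rescale n ν) z = (Real.sqrt n : ℂ) * cauchy ν ((Real.sqrt n : ℂ) * z) := by
  have hs : (0:ℝ) < Real.sqrt n := Real.sqrt_pos.2 (by exact_mod_cast hn)
  have hsc : (Real.sqrt n : ℂ) ≠ 0 := by exact_mod_cast hs.ne'
  rw [cauchy, rescale, integral_map (by fun_prop) (X_cont hz).aestronglyMeasurable, cauchy,
    ← integral_const_mul]
  refine integral_congr_ae (ae_of_all _ fun u => ?_)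
  simp only
  have hz' : 0 < ((Real.sqrt n : ℂ) * z).im := by
    rw [Complex.im_ofReal_mul]
    exact mul_pos hs hz
  push_cast
  have h1 := sub_ne hz (u / Real.sqrt n)
  have h2 := sub_ne hz' u
  push_cast at h1
  rw [show (Real.sqrt n : ℂ) * z - u = (Real.sqrt n : ℂ) * (z - u / (Real.sqrt n : ℂ)) by
    field_simp]
  rw [mul_inv, mul_inv_cancel_left₀ hsc]

/-- algebraic expansion bound for k -/
lemma k_alg {N t v c0 m3 m4 m8 a nr kk : ℝ} (hN : 1 ≤ N) (hv : 0 < v) (hc0 : 0 < c0)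
    (ht : c0 ≤ t) (ha : |a| ≤ |m3|) (hm4 : 0 ≤ m4) (hm8 : 0 ≤ m8)
    (hkk : kk ≤ 2) (hkk0 : 0 ≤ kk) (hnr0 : 0 ≤ nr)
    (hnr : nr ≤ (2 * m4 + 16 * m8 / (N ^ 2 * t ^ 3 * v)) / (N * t ^ 4)) :
    t * nr + kk / N * (1 / t ^ 2 + |a| / t ^ 3 + nr) ≤
      ((2 * m4 + 16 * m8 / c0 ^ 3) / c0 + 2 * (1 + |m3| / c0 + (2 * m4 + 16 * m8 / c0 ^ 3) / c0 ^ 2))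
        / N * (1 + 1 / (N ^ 2 * v)) / t ^ 2 := by
  have ht0 : 0 < t := lt_of_lt_of_le hc0 ht
  set M := 2 * m4 + 16 * m8 / c0 ^ 3 with hM
  have hM0 : 0 ≤ M := by positivity
  set X := 1 + 1 / (N ^ 2 * v) with hX
  have hX1 : 1 ≤ X := by
    have : 0 ≤ 1 / (N ^ 2 * v) := by positivity
    linarith
  have h1 : 2 * m4 + 16 * m8 / (N ^ 2 * t ^ 3 * v) ≤ M * X := by
    have a1 : 16 * m8 / (N ^ 2 * t ^ 3 * v) ≤ 16 * m8 / c0 ^ 3 * (1 / (N ^ 2 * v)) := by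
      rw [div_mul_div_comm, mul_one]
      refine div_le_div_of_nonneg_left (by positivity) (by positivity) ?_
      have := pow_le_pow_left₀ hc0.le ht 3
      have := mul_le_mul_of_nonneg_right this (show 0 ≤ N ^ 2 * v by positivity)
      linarith
    have a2 : 0 ≤ 2 * m4 * (1 / (N ^ 2 * v)) := by positivity
    have a3 : 0 ≤ 16 * m8 / c0 ^ 3 := by positivity
    rw [hM, hX]
    nlinarith
  have h2 : nr ≤ M * X / (N * t ^ 4) := hnr.trans (div_le_div_of_nonneg_right h1 (by positivity))
  have h3 : t * nr ≤ M / c0 / N * X / t ^ 2 := by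
    calc t * nr ≤ t * (M * X / (N * t ^ 4)) := by gcongr
      _ = M * X / (N * t ^ 2) * (1 / t) := by field_simp
      _ ≤ M * X / (N * t ^ 2) * (1 / c0) := by gcongr
      _ = _ := by field_simp
  have h4 : 1 / t ^ 2 + |a| / t ^ 3 + nr ≤ (1 + |m3| / c0 + M / c0 ^ 2) * X / t ^ 2 := by
    have b1 : 1 / t ^ 2 ≤ X / t ^ 2 := by gcongr
    have b2 : |a| / t ^ 3 ≤ |m3| / c0 * X / t ^ 2 := by
      calc |a| / t ^ 3 ≤ |m3| / t ^ 3 := by gcongr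
        _ = |m3| * 1 / t ^ 2 * (1 / t) := by field_simp
        _ ≤ |m3| * X / t ^ 2 * (1 / c0) := by gcongr
        _ = _ := by field_simp
    have b3 : nr ≤ M / c0 ^ 2 * X / t ^ 2 := by
      calc nr ≤ M * X / (N * t ^ 4) := h2
        _ = M * X / t ^ 2 * (1 / t ^ 2) * (1 / N) := by field_simp
        _ ≤ M * X / t ^ 2 * (1 / c0 ^ 2) * (1 / 1) := by gcongr
        _ = _ := by field_simp
    calc _ ≤ X / t ^ 2 + |m3| / c0 * X / t ^ 2 + M / c0 ^ 2 * X / t ^ 2 := by linarith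
      _ = _ := by ring
  have h5 : kk / N * (1 / t ^ 2 + |a| / t ^ 3 + nr) ≤
      2 / N * ((1 + |m3| / c0 + M / c0 ^ 2) * X / t ^ 2) := by
    gcongr
  calc _ ≤ M / c0 / N * X / t ^ 2 + 2 / N * ((1 + |m3| / c0 + M / c0 ^ 2) * X / t ^ 2) := by
        linarith
    _ = _ := by ring

/-- algebraic bound for κ -/
lemma κ_alg {N t v c0 m3 m4 m8 a u κ f Ierr kk : ℝ} (hN : 1 ≤ N) (hv : 0 < v) (hc0 : 0 < c0)
    (ht : c0 ≤ t) (ha : |a| ≤ |m3|) (hu : |u| ≤ t) (hm4 : 0 ≤ m4) (hm8 : 0 ≤ m8)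
    (hkk : kk ≤ 2) (hkk0 : 0 ≤ kk)
    (hf : |f - t| ≤ 2 / N)
    (hI : |Ierr| ≤ 24 * m4 / (N * t ^ 4) + 64 * m8 / (N ^ 3 * t ^ 6 * v ^ 2))
    (hκ : κ = f ^ 2 / t ^ 2 * (1 / t ^ 2 * (1 + 2 * a * u / t ^ 2) + Ierr) - kk ^ 2 / (N * t ^ 2)) :
    |κ - 1 / t ^ 2 * (1 + 2 * a * u / t ^ 2)| ≤
      ((4 / c0 + 4 / c0 ^ 2) * (1 / c0 ^ 2 * (1 + 2 * |m3| / c0)) +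
        (1 + 4 / c0 + 4 / c0 ^ 2) * (24 * m4 / c0 ^ 4 + 64 * m8 / c0 ^ 6) + 4 / c0 ^ 2) *
        (1 / N + 1 / (N ^ 3 * v ^ 2)) := by
  have ht0 : 0 < t := lt_of_lt_of_le hc0 ht
  have hN0 : 0 < N := by linarith
  set L := 1 / t ^ 2 * (1 + 2 * a * u / t ^ 2) with hL
  set Y := 1 / N + 1 / (N ^ 3 * v ^ 2) with hY
  have hY1 : 1 / N ≤ Y := by
    have : 0 ≤ 1 / (N ^ 3 * v ^ 2) := by positivity
    linarith
  have hY2 : 1 / (N ^ 3 * v ^ 2) ≤ Y := by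
    have : 0 ≤ 1 / N := by positivity
    linarith
  have hLb : |L| ≤ 1 / c0 ^ 2 * (1 + 2 * |m3| / c0) := by
    rw [hL, abs_mul, abs_of_pos (show 0 < 1 / t ^ 2 by positivity)]
    have : |2 * a * u / t ^ 2| ≤ 2 * |m3| / c0 := by
      rw [abs_div, abs_mul, abs_mul, abs_of_pos (show 0 < t ^ 2 by positivity), abs_two]
      calc 2 * |a| * |u| / t ^ 2 ≤ 2 * |m3| * t / t ^ 2 := by gcongr
        _ = 2 * |m3| / t := by field_simp
        _ ≤ 2 * |m3| / c0 := by gcongr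
    gcongr
    calc |1 + 2 * a * u / t ^ 2| ≤ |1| + |2 * a * u / t ^ 2| := abs_add_le _ _
      _ ≤ _ := by rw [abs_one]; linarith
  have hg : |f ^ 2 / t ^ 2 - 1| ≤ (4 / c0 + 4 / c0 ^ 2) * (1 / N) := by
    have e : f ^ 2 / t ^ 2 - 1 = (f - t) * (2 / t) + (f - t) ^ 2 / t ^ 2 := by
      field_simp; ring
    have h1 : |(f - t) * (2 / t)| ≤ 4 / c0 * (1 / N) := by
      rw [abs_mul, abs_of_pos (show 0 < 2 / t by positivity)]
      calc |f - t| * (2 / t) ≤ 2 / N * (2 / c0) := by gcongr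
        _ = _ := by ring
    have h2 : |(f - t) ^ 2 / t ^ 2| ≤ 4 / c0 ^ 2 * (1 / N) := by
      rw [abs_div, abs_pow, abs_of_pos (show 0 < t ^ 2 by positivity)]
      calc |f - t| ^ 2 / t ^ 2 ≤ (2 / N) ^ 2 / c0 ^ 2 := by gcongr
        _ = 4 / c0 ^ 2 * (1 / N) * (1 / N) := by ring
        _ ≤ 4 / c0 ^ 2 * (1 / N) * (1 / 1) := by gcongr
        _ = _ := by ring
    rw [e]
    refine (abs_add_le _ _).trans ?_
    linarith
  have hg2 : |f ^ 2 / t ^ 2| ≤ 1 + 4 / c0 + 4 / c0 ^ 2 := by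
    have : (4 / c0 + 4 / c0 ^ 2) * (1 / N) ≤ (4 / c0 + 4 / c0 ^ 2) * (1 / 1) := by gcongr
    calc |f ^ 2 / t ^ 2| = |(f ^ 2 / t ^ 2 - 1) + 1| := by ring_nf
      _ ≤ |f ^ 2 / t ^ 2 - 1| + |1| := abs_add_le _ _
      _ ≤ _ := by rw [abs_one]; linarith
  have hI2 : |Ierr| ≤ (24 * m4 / c0 ^ 4 + 64 * m8 / c0 ^ 6) * Y := by
    refine hI.trans ?_
    have b1 : 24 * m4 / (N * t ^ 4) ≤ 24 * m4 / c0 ^ 4 * Y := by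
      calc 24 * m4 / (N * t ^ 4) = 24 * m4 / t ^ 4 * (1 / N) := by field_simp
        _ ≤ 24 * m4 / c0 ^ 4 * Y := by gcongr
    have b2 : 64 * m8 / (N ^ 3 * t ^ 6 * v ^ 2) ≤ 64 * m8 / c0 ^ 6 * Y := by
      calc 64 * m8 / (N ^ 3 * t ^ 6 * v ^ 2) = 64 * m8 / t ^ 6 * (1 / (N ^ 3 * v ^ 2)) := by
            field_simp
        _ ≤ 64 * m8 / c0 ^ 6 * Y := by gcongr
    linarith
  have hk3 : |kk ^ 2 / (N * t ^ 2)| ≤ 4 / c0 ^ 2 * Y := by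
    rw [abs_of_nonneg (by positivity)]
    calc kk ^ 2 / (N * t ^ 2) ≤ 2 ^ 2 / (N * c0 ^ 2) := by gcongr
      _ = 4 / c0 ^ 2 * (1 / N) := by field_simp; norm_num
      _ ≤ _ := by gcongr
  have e : κ - L = (f ^ 2 / t ^ 2 - 1) * L + f ^ 2 / t ^ 2 * Ierr - kk ^ 2 / (N * t ^ 2) := by
    rw [hκ]; ring
  rw [e]
  have c1 : |(f ^ 2 / t ^ 2 - 1) * L| ≤
      (4 / c0 + 4 / c0 ^ 2) * Y * (1 / c0 ^ 2 * (1 + 2 * |m3| / c0)) := by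
    rw [abs_mul]
    refine mul_le_mul (hg.trans ?_) hLb (abs_nonneg _) (by positivity)
    gcongr
  have c2 : |f ^ 2 / t ^ 2 * Ierr| ≤
      (1 + 4 / c0 + 4 / c0 ^ 2) * ((24 * m4 / c0 ^ 4 + 64 * m8 / c0 ^ 6) * Y) := by
    rw [abs_mul]
    exact mul_le_mul hg2 hI2 (abs_nonneg _) (by positivity)
  calc _ ≤ |(f ^ 2 / t ^ 2 - 1) * L| + |f ^ 2 / t ^ 2 * Ierr| + |kk ^ 2 / (N * t ^ 2)| :=
        (abs_sub _ _).trans (add_le_add_left (abs_add_le _ _) _)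
    _ ≤ _ := by linarith

lemma mom_nonneg {μ : Measure ℝ} {k : ℕ} (hk : Even k) : 0 ≤ mom μ k :=
  integral_nonneg fun u => hk.pow_nonneg u

/-- constants -/
def bb (μ : Measure ℝ) : ℝ := ∫ u : ℝ, |u| ∂μ
def c0c (μ : Measure ℝ) : ℝ := min (bb μ / 4) 1
def C1c (μ : Measure ℝ) : ℝ :=
  ((2 * mom μ 4 + 16 * mom μ 8 / c0c μ ^ 3) / c0c μ + 2 * (1 + |mom μ 3| / c0c μ +
    (2 * mom μ 4 + 16 * mom μ 8 / c0c μ ^ 3) / c0c μ ^ 2))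
def C2c (μ : Measure ℝ) : ℝ :=
  ((4 / c0c μ + 4 / c0c μ ^ 2) * (1 / c0c μ ^ 2 * (1 + 2 * |mom μ 3| / c0c μ)) +
        (1 + 4 / c0c μ + 4 / c0c μ ^ 2) * (24 * mom μ 4 / c0c μ ^ 4 + 64 * mom μ 8 / c0c μ ^ 6) +
          4 / c0c μ ^ 2)
def Cc (μ : Measure ℝ) : ℝ := 64 * mom μ 8 + C1c μ + C2c μ + 1

lemma c0_pos {μ : Measure ℝ} [IsProbabilityMeasure μ] (h8 : Integrable (fun u : ℝ => u ^ 8) μ)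
    (h2 : mom μ 2 = 1) : 0 < c0c μ :=
  lt_min (by have := absmom_pos h8 h2; unfold bb; positivity) one_pos

lemma pt_of {μ : Measure ℝ} [IsProbabilityMeasure μ] (h8 : Integrable (fun u : ℝ => u ^ 8) μ)
    (h1 : mom μ 1 = 0) (h2 : mom μ 2 = 1) {s N : ℝ} (hs : 0 < s) (hN : s ^ 2 = N) (hN2 : 2 ≤ N)
    (hNb : 1 / (N - 1) ≤ (bb μ / 2) ^ 2) (hNb2 : 2 ≤ N * (bb μ / 4) ^ 2)
    {W z : ℂ} (hW : 0 < W.im) (hz : 0 < z.im)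
    (hzW : (s : ℂ) * z = N * W - (N - 1) * recip μ W) :
    Pt (Cc μ) (c0c μ) (mom μ 3 / s) N z (W / s) (s * KK μ W) (s * cauchy μ W) (N * JJ μ W) := by
  have hc0 := c0_pos h8 h2
  have hb : 0 < bb μ := absmom_pos h8 h2
  have hsc : (s : ℂ) ≠ 0 := by exact_mod_cast hs.ne'
  have hNc : (N : ℂ) = s ^ 2 := by rw [← hN]; push_cast; rfl
  have hN0 : 0 < N := by linarith
  have hW0 : W ≠ 0 := by intro h; simp [h] at hW
  have hl := W_norm_pos hW
  set K := KK μ W with hK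
  set J := JJ μ W with hJ
  have hJ0 : 0 ≤ J := JJ_nonneg μ hW
  have hKim : K.im = - W.im * J := KK_im μ hW
  have hrec : recip μ W = W - K := by rw [hK, KK]; ring
  have hzW2 : (s : ℂ) * z = W + (N - 1) * K := by rw [hzW, hrec]; ring
  have him : s * z.im = W.im * (1 - (N - 1) * J) := by
    have := congrArg Complex.im hzW2
    rw [Complex.im_ofReal_mul, Complex.add_im, ← Complex.ofReal_one, ← Complex.ofReal_sub,
      Complex.im_ofReal_mul, hKim] at this
    rw [this]; ring
  have hJ1 : (N - 1) * J < 1 := by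
    have : 0 < W.im * (1 - (N - 1) * J) := him ▸ mul_pos hs hz
    have := (mul_pos_iff_of_pos_left hW).1 this
    linarith
  have hNJ : N * J ≤ 2 := by nlinarith
  have hKJ : ‖K‖ ^ 2 ≤ J := KK_sq_le h8 h1 h2 hW
  have hk2 : ‖(s : ℂ) * K‖ ≤ 2 := by
    rw [norm_mul, Complex.norm_real, Real.norm_of_nonneg hs.le]
    have : (s * ‖K‖) ^ 2 ≤ 2 := by rw [mul_pow, hN]; nlinarith
    nlinarith [norm_nonneg K]
  have hTn : ‖W / (s : ℂ)‖ = ‖W‖ / s := by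
    rw [norm_div, Complex.norm_real, Real.norm_of_nonneg hs.le]
  have hTim : (W / (s : ℂ)).im = W.im / s := by simp
  have hTre : (W / (s : ℂ)).re = W.re / s := by simp
  have hKb : ‖K‖ ≤ bb μ / 2 := by
    have : ‖K‖ ^ 2 ≤ (bb μ / 2) ^ 2 := by
      refine hKJ.trans (le_trans ?_ hNb)
      rw [le_div_iff₀ (by linarith)]; linarith
    exact (pow_le_pow_iff_left₀ (norm_nonneg _) (by positivity) two_ne_zero).1 this
  have hlow := JJ_lower h8 h1 h2 hW hKb
  have hc : c0c μ ≤ ‖W / (s : ℂ)‖ := by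
    refine (min_le_left _ _).trans ?_
    rw [hTn, le_div_iff₀ hs]
    have e1 : (bb μ / 2) ^ 2 * N ≤ 2 * (‖W‖ ^ 2 + 1) := by
      calc (bb μ / 2) ^ 2 * N ≤ J * (‖W‖ ^ 2 + 1) * N := by
            exact mul_le_mul_of_nonneg_right hlow hN0.le
        _ = (N * J) * (‖W‖ ^ 2 + 1) := by ring
        _ ≤ _ := by gcongr
    have e2 : (bb μ / 4 * s) ^ 2 ≤ ‖W‖ ^ 2 := by
      rw [mul_pow, hN]; nlinarith
    exact (pow_le_pow_iff_left₀ (by positivity) (norm_nonneg _) two_ne_zero).1 e2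
  have hm4 : 0 ≤ mom μ 4 := mom_nonneg (by decide)
  have hm8 : 0 ≤ mom μ 8 := mom_nonneg (by decide)
  have hC1 : 0 ≤ C1c μ := by unfold C1c; positivity
  have hC2 : 0 ≤ C2c μ := by unfold C2c; positivity
  have hv : 0 < (W / (s : ℂ)).im := by rw [hTim]; positivity
  have ha : |mom μ 3 / s| ≤ |mom μ 3| := by
    rw [abs_div, abs_of_pos hs]
    apply div_le_self (abs_nonneg _)
    nlinarith
  have hcn := cauchy_ne μ hW
  have hGinv : ((s : ℂ) * cauchy μ W)⁻¹ = recip μ W / s := by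
    rw [recip, mul_inv]; field_simp
  have hT0 : W / (s : ℂ) ≠ 0 := div_ne_zero hW0 hsc
  have htl : 0 < ‖W / (s : ℂ)‖ := norm_pos_iff.2 hT0
  refine ⟨hv, mul_ne_zero hsc hcn, ?_, ?_, ?_, hk2, hc, by positivity, hNJ, ?_, ?_, ?_, ?_⟩
  · rw [Complex.im_ofReal_mul]
    exact mul_neg_of_pos_of_neg hs (cauchy_im_neg μ hW)
  · rw [hGinv, hrec]
    have : z = (W + (N - 1) * K) / s := by rw [← hzW2]; field_simp
    rw [this, hNc]; field_simp; ring
  · have : z = (W + (N - 1) * K) / s := by rw [← hzW2]; field_simp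
    rw [this, hNc]; field_simp
  · rw [Complex.im_ofReal_mul, hKim, hTim, ← hN]; field_simp
  · have := JJ_upper h8 h2 hW
    rw [hGinv, hTn, hTim, norm_div, Complex.norm_real, Real.norm_of_nonneg hs.le]
    calc N * J ≤ N * (‖recip μ W‖ ^ 2 * (4 / ‖W‖ ^ 4 + 64 * mom μ 8 / (‖W‖ ^ 8 * W.im ^ 2))) := by
          gcongr
      _ = (‖recip μ W‖ / s) ^ 2 * (4 / (‖W‖ / s) ^ 4 + 64 * mom μ 8 /
            (N ^ 3 * (‖W‖ / s) ^ 8 * (W.im / s) ^ 2)) := by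
          rw [← hN]; field_simp
      _ ≤ _ := by
          gcongr
          unfold Cc; linarith
  · obtain ⟨r, hr1, hr2⟩ := KK_exp h8 h1 h2 hW
    have e : (s : ℂ) * K - 1 / (W / s) - (mom μ 3 / s : ℝ) / (W / s) ^ 2 =
        (W / s) * (N * r) - (s * K) / N * (1 / (W / s) ^ 2 + (mom μ 3 / s : ℝ) / (W / s) ^ 3
          + N * r) := by
      rw [← hK] at hr1
      push_cast
      rw [hNc]
      conv_lhs => rw [hr1]
      field_simp
      ring
    have hr3 : ‖(N : ℂ) * r‖ ≤ (2 * mom μ 4 + 16 * mom μ 8 /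
        (N ^ 2 * ‖W / (s : ℂ)‖ ^ 3 * (W / (s : ℂ)).im)) / (N * ‖W / (s : ℂ)‖ ^ 4) := by
      rw [norm_mul, Complex.norm_real, Real.norm_of_nonneg hN0.le, hTn, hTim]
      calc N * ‖r‖ ≤ N * ((2 / ‖W‖ * mom μ 4 + 16 / (‖W‖ ^ 4 * W.im) * mom μ 8) / ‖W‖ ^ 3) := by
            gcongr
        _ = _ := by rw [← hN]; field_simp
    have hm := k_alg (by linarith) hv hc0 hc ha hm4 hm8 hk2 (norm_nonneg _) (norm_nonneg _) hr3
    rw [e]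
    calc _ ≤ ‖W / (s : ℂ)‖ * ‖(N : ℂ) * r‖ + ‖(s : ℂ) * K‖ / N * (1 / ‖W / (s : ℂ)‖ ^ 2
            + |mom μ 3 / s| / ‖W / (s : ℂ)‖ ^ 3 + ‖(N : ℂ) * r‖) := by
          refine (norm_sub_le _ _).trans ?_
          rw [norm_mul (W / (s : ℂ)), norm_mul (_ / _), norm_div _ (N : ℂ), Complex.norm_real N,
            Real.norm_of_nonneg hN0.le]
          gcongr
          refine (norm_add_le _ _).trans ?_
          gcongr
          refine (norm_add_le _ _).trans ?_
          rw [norm_div, norm_div, norm_pow, norm_pow, norm_one, Complex.norm_real,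
            Real.norm_eq_abs]
      _ ≤ _ := hm
      _ ≤ _ := by
          change C1c μ / N * _ / _ ≤ _
          gcongr
          unfold Cc; linarith
  · have hI := I2_exp h8 h2 hW
    set I := ∫ u : ℝ, u ^ 2 * ‖(W - (u : ℂ))⁻¹‖ ^ 2 ∂μ with hIdef
    have hf : |‖recip μ W / (s : ℂ)‖ - ‖W / (s : ℂ)‖| ≤ 2 / N := by
      refine (abs_norm_sub_norm_le _ _).trans ?_
      have : recip μ W / (s : ℂ) - W / s = - ((s : ℂ) * K / N) := by
        rw [hrec, hNc]; field_simp; ring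
      rw [this, norm_neg, norm_div, Complex.norm_real, Real.norm_of_nonneg hN0.le]
      gcongr
    have hu : |(W / (s : ℂ)).re| ≤ ‖W / (s : ℂ)‖ := Complex.abs_re_le_norm _
    have hm := κ_alg (N := N) (κ := N * J)
      (Ierr := N * (I - (1 / ‖W‖ ^ 2 + 2 * W.re / ‖W‖ ^ 4 * mom μ 3)))
      (by linarith) hv hc0 hc ha hu hm4 hm8 hk2 (norm_nonneg _) hf ?_ ?_
    · refine hm.trans ?_
      change C2c μ * _ ≤ _
      gcongr
      unfold Cc; linarith
    · rw [abs_mul, abs_of_pos hN0, hTn, hTim]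
      calc _ ≤ N * (24 / ‖W‖ ^ 4 * mom μ 4 + 64 / (‖W‖ ^ 6 * W.im ^ 2) * mom μ 8) := by gcongr
        _ = _ := by rw [← hN]; field_simp
    · have hE := JJ_eq2 (μ := μ) hW
      have hd : ‖recip μ W‖ ^ 2 * ‖cauchy μ W - W⁻¹‖ ^ 2 = ‖K‖ ^ 2 / ‖W‖ ^ 2 := by
        rw [← mul_pow, ← norm_mul, ← div_pow, ← norm_div]
        congr 2
        rw [mul_sub, recip_mul μ hW, hrec]; field_simp; ring
      rw [← hJ, ← hIdef, mul_sub, hd] at hE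
      rw [hE, hTn, hTre, norm_div, norm_mul, Complex.norm_real, Real.norm_of_nonneg hs.le, ← hN]
      field_simp
      ring

lemma lemmaA {μ : Measure ℝ} [IsProbabilityMeasure μ] (h8 : Integrable (fun u : ℝ => u ^ 8) μ)
    (h1 : mom μ 1 = 0) (h2 : mom μ 2 = 1) (Z : ℕ → ℂ → ℂ) (ν : ℕ → Measure ℝ)
    (hbox : ∀ n : ℕ, 1 ≤ n → IsBoxPow μ n (Z n) (ν n)) :
    ∃ n0 : ℕ, 2 ≤ n0 ∧ ∀ n : ℕ, n0 ≤ n → ∀ z : ℂ, 0 < z.im → ∃ T k : ℂ, ∃ κ : ℝ,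
      Pt (Cc μ) (c0c μ) (mom μ 3 / Real.sqrt n) n z T k (cauchy (rescale n (ν n)) z) κ := by
  have hb : 0 < bb μ := absmom_pos h8 h2
  obtain ⟨m, hm⟩ := exists_nat_ge (1 / (bb μ / 2) ^ 2 + 2 / (bb μ / 4) ^ 2)
  have p1 : 0 < 1 / (bb μ / 2) ^ 2 := by positivity
  have p2 : 0 < 2 / (bb μ / 4) ^ 2 := by positivity
  refine ⟨m + 2, by omega, fun n hn z hz => ?_⟩
  obtain ⟨⟨⟨σ, hσ, hσ2⟩, hsub⟩, hν, hrec⟩ := hbox n (by omega)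
  have hnr : (m : ℝ) + 2 ≤ n := by exact_mod_cast hn
  have hs : (0:ℝ) < Real.sqrt n := Real.sqrt_pos.2 (by linarith)
  set s := Real.sqrt n with hsdef
  have hsz : 0 < ((s : ℂ) * z).im := by rw [Complex.im_ofReal_mul]; exact mul_pos hs hz
  have hN : s ^ 2 = (n : ℝ) := Real.sq_sqrt (by positivity)
  set W := Z n (s * z) with hWdef
  have hW : 0 < W.im := by rw [hWdef, hσ2 _ hsz]; exact recip_im_pos σ hsz
  have hP := pt_of h8 h1 h2 hs hN (by linarith) ?_ ?_ hW hz ?_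
  · have hG : cauchy (rescale n (ν n)) z = (s : ℂ) * cauchy μ W := by
      rw [cauchy_rescale (by omega) (ν n) hz]
      congr 1
      exact inv_injective (hrec _ hsz)
    rw [hG]
    exact ⟨_, _, _, hP⟩
  · rw [div_le_iff₀ (by linarith), ← div_le_iff₀' (by positivity)]; linarith
  · rw [← div_le_iff₀ (by positivity)]; linarith
  · simpa using hsub _ hsz

section ptlemmas
variable {C c0 a N x ε κ : ℝ} {T k G : ℂ}

lemma Pt.F_eq {z : ℂ} (h : Pt C c0 a N z T k G κ) : G⁻¹ = T - k / N := by
  have := h.hz1.symm.trans h.hz2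
  have e : G⁻¹ = T + (1 - 1 / (N : ℂ)) * k - k := by rw [← this]; ring
  rw [e]; ring

lemma Pt.v_eq (h : Pt C c0 a N (x + ε * I) T k G κ) :
    T.im - ε = (1 - 1 / N) * κ * T.im := by
  have h2 := congrArg Complex.im h.hz2
  rw [show (1 - 1 / (N : ℂ)) = ((1 - 1 / N : ℝ) : ℂ) by push_cast; rfl, Complex.add_im,
    Complex.add_im, Complex.im_ofReal_mul, Complex.im_ofReal_mul, h.hkim] at h2
  simp at h2
  rw [h2]; simp only [one_div]; ring

lemma Pt.B_eq {z : ℂ} (h : Pt C c0 a N z T k G κ) :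
    - G.im = T.im * (1 + κ / N) * ‖G‖ ^ 2 := by
  have h2 := congrArg Complex.im h.F_eq
  rw [Complex.inv_im, Complex.sub_im, Complex.div_ofReal_im, h.hkim,
    Complex.normSq_eq_norm_sq] at h2
  have : ‖G‖ ≠ 0 := norm_ne_zero_iff.2 h.hG
  rw [div_eq_iff (by positivity)] at h2
  rw [h2]; ring

lemma Pt.F_close {z : ℂ} (h : Pt C c0 a N z T k G κ) (hN : 0 < N) :
    |‖G‖⁻¹ - ‖T‖| ≤ 2 / N := by
  rw [← norm_inv]
  refine (abs_norm_sub_norm_le _ _).trans ?_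
  rw [h.F_eq, sub_sub_cancel_left, norm_neg, norm_div, Complex.norm_real,
    Real.norm_of_nonneg hN.le]
  exact div_le_div_of_nonneg_right h.hk hN.le

lemma Pt.T_close {z : ℂ} (h : Pt C c0 a N z T k G κ) (hN : 1 ≤ N) :
    ‖T - z‖ ≤ 2 := by
  have : T - z = - (((1 - 1 / N : ℝ) : ℂ) * k) := by
    rw [h.hz2]; push_cast; ring
  rw [this, norm_neg, norm_mul, Complex.norm_real]
  have h1 : 1 / N ≤ 1 := by rw [div_le_one (by linarith)]; exact hN
  have h2 : 0 < 1 / N := by positivity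
  rw [Real.norm_of_nonneg (by linarith)]
  nlinarith [h.hk, norm_nonneg k]

lemma Pt.near (h : Pt C c0 a N (x + ε * I) T k G κ) (hc0 : 0 < c0) (hN2 : 2 ≤ N)
    (hN4 : 4 / c0 ≤ N) (hε : 0 < ε) (hε1 : ε ≤ 1) (hx : |x| ≤ 10) :
    ‖T‖ ≤ 13 ∧ ‖G‖ ≤ 2 / c0 ∧ ‖G‖⁻¹ ≤ 14 ∧ - G.im ≤ (2 * (2 / c0) ^ 2) * T.im := by
  have h1 := h.T_close (by linarith)
  have h2 := h.F_close (by linarith)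
  have hz : ‖(x : ℂ) + ε * I‖ ≤ 11 := by
    refine (norm_add_le _ _).trans ?_
    rw [norm_mul, Complex.norm_real, Complex.norm_real, norm_I, mul_one, Real.norm_eq_abs,
      Real.norm_of_nonneg hε.le]
    linarith
  have hT : ‖T‖ ≤ 13 := by
    have := norm_sub_norm_le T ((x : ℂ) + ε * I)
    linarith
  have e1 : 2 / N ≤ c0 / 2 := by
    rw [div_le_iff₀ hc0] at hN4
    rw [div_le_div_iff₀ (by linarith) (by norm_num)]; linarith
  have e2 : 2 / N ≤ 1 := by rw [div_le_one (by linarith)]; exact hN2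
  have h3 := abs_le.1 h2
  have hc := h.hc
  have hGp : 0 < ‖G‖ := norm_pos_iff.2 h.hG
  have hG : ‖G‖ ≤ 2 / c0 := by
    have : c0 / 2 ≤ ‖G‖⁻¹ := by linarith [h3.1]
    have := inv_anti₀ (by positivity) this
    rwa [inv_inv, inv_div] at this
  refine ⟨hT, hG, by linarith [h3.2], ?_⟩
  rw [h.B_eq]
  have hT0 := h.hT
  have : κ / N ≤ 1 := by
    rw [div_le_one (by linarith)]; linarith [h.hκ2]
  calc T.im * (1 + κ / N) * ‖G‖ ^ 2 ≤ T.im * (1 + 1) * (2 / c0) ^ 2 := by gcongr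
    _ = _ := by ring

end ptlemmas

open Asymptotics

lemma O1mul {α : Type} {f g q : α → ℝ} {l : Filter α} (hf : f =O[l] (fun _ => (1:ℝ)))
    (hg : g =O[l] q) : (fun i => f i * g i) =O[l] q := by
  simpa using hf.mul hg

lemma O11 {α : Type} {f g : α → ℝ} {l : Filter α} (hf : f =O[l] (fun _ => (1:ℝ)))
    (hg : g =O[l] (fun _ => (1:ℝ))) : (fun i => f i * g i) =O[l] (fun _ => (1:ℝ)) := O1mul hf hg

lemma Opt {α : Type} {f q : α → ℝ} (c : ℝ) (h : ∀ i, |f i| ≤ c * q i) (hq : ∀ i, 0 ≤ q i) :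
    f =O[⊤] q :=
  isBigO_top.2 ⟨c, fun i => by
    rw [Real.norm_eq_abs, Real.norm_of_nonneg (hq i)]; exact h i⟩

lemma Opt1 {α : Type} {f : α → ℝ} (c : ℝ) (h : ∀ i, |f i| ≤ c) :
    f =O[⊤] (fun _ => (1:ℝ)) := Opt c (by simpa using h) (by simp)

lemma near_main {α : Type} (N h ε x θ κ : α → ℝ) (T k G : α → ℂ) (C c0 m3 : ℝ)
    (hC : 0 ≤ C) (hc0 : 0 < c0)
    (hP : ∀ i, Pt C c0 (m3 * h i) (N i) (x i + ε i * I) (T i) (k i) (G i) (κ i))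
    (hN : ∀ i, 1 / N i = h i ^ 2) (hN2 : ∀ i, 2 ≤ N i) (hN4 : ∀ i, 4 / c0 ≤ N i)
    (hh : ∀ i, 0 < h i) (hε : ∀ i, 0 < ε i) (hε8 : ∀ i, ε i ≤ h i ^ 8) (hx : ∀ i, |x i| ≤ 10)
    (hv : ∀ i, θ i ≤ (T i).im) (hθ0 : ∀ i, 0 < θ i) (hθ5 : ∀ i, h i ^ 5 ≤ θ i ^ 2)
    (hθ3 : ∀ i, h i ^ 3 ≤ θ i) :
    (fun i => (G i).im * ((2 * (G i).re - x i) ^ 2 - (m3 * h i) ^ 2 *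
      (1 + 3 * (G i).re ^ 2 - (G i).im ^ 2 + 5 * (G i).re ^ 4 - 10 * (G i).re ^ 2 * (G i).im ^ 2
        + (G i).im ^ 4))) =O[⊤] (fun i => h i ^ 3) := by
  have hh1 : ∀ i, h i ≤ 1 := fun i => by
    have h1 : h i ^ 2 ≤ 1 := by
      rw [← hN, div_le_one (by linarith [hN2 i])]; linarith [hN2 i]
    nlinarith [hh i]
  have hε1 : ∀ i, ε i ≤ 1 := fun i => (hε8 i).trans (pow_le_one₀ (hh i).le (hh1 i))
  have hb := fun i => (hP i).near hc0 (hN2 i) (hN4 i) (hε i) (hε1 i) (hx i)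
  have hN0 : ∀ i, 0 < N i := fun i => by linarith [hN2 i]
  have hv0 : ∀ i, 0 < (T i).im := fun i => (hP i).hT
  have ht0 : ∀ i, 0 < ‖T i‖ := fun i => hc0.trans_le (hP i).hc
  -- η
  set η : α → ℝ := fun i => h i ^ 2 + h i ^ 6 / (T i).im ^ 2 + ε i / (T i).im with hη
  have hη0 : ∀ i, 0 < η i := fun i => by
    have := hh i; have := hv0 i; have := hε i; simp only [hη]; positivity
  -- basic bounded
  have Bu : (fun i => (T i).re) =O[⊤] (fun _ => (1:ℝ)) :=
    Opt1 13 fun i => (Complex.abs_re_le_norm _).trans (hb i).1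
  have Bv : (fun i => (T i).im) =O[⊤] (fun _ => (1:ℝ)) :=
    Opt1 13 fun i => (Complex.abs_im_le_norm _).trans (hb i).1
  have BA : (fun i => (G i).re) =O[⊤] (fun _ => (1:ℝ)) :=
    Opt1 (2 / c0) fun i => (Complex.abs_re_le_norm _).trans (hb i).2.1
  have BB : (fun i => (G i).im) =O[⊤] (fun _ => (1:ℝ)) :=
    Opt1 (2 / c0) fun i => (Complex.abs_im_le_norm _).trans (hb i).2.1
  have Bs : (fun i => 1 / ‖T i‖ ^ 2) =O[⊤] (fun _ => (1:ℝ)) := by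
    refine Opt1 (1 / c0 ^ 2) fun i => ?_
    rw [abs_of_pos (by have := ht0 i; positivity)]
    have := (hP i).hc
    gcongr
  have Bκ : κ =O[⊤] (fun _ => (1:ℝ)) := by
    refine Opt1 2 fun i => ?_
    rw [abs_of_nonneg (hP i).hκ0]; exact (hP i).hκ2
  have BG : (fun i => (G i).im) =O[⊤] (fun i => (T i).im) := by
    refine Opt (2 * (2 / c0) ^ 2) (fun i => ?_) (fun i => (hv0 i).le)
    rw [abs_of_neg (hP i).hG_im]; exact (hb i).2.2.2
  have Oh1 : h =O[⊤] (fun _ => (1:ℝ)) := Opt1 1 fun i => by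
    rw [abs_of_pos (hh i)]; exact hh1 i
  have Oh2η : (fun i => h i ^ 2) =O[⊤] η := by
    refine Opt 1 (fun i => ?_) (fun i => (hη0 i).le)
    have := hh i; have := hv0 i; have := hε i
    rw [abs_of_pos (by positivity)]
    simp only [hη]
    have : 0 ≤ h i ^ 6 / (T i).im ^ 2 + ε i / (T i).im := by positivity
    linarith
  have Oεη : (fun i => ε i / (T i).im) =O[⊤] η := by
    refine Opt 1 (fun i => ?_) (fun i => (hη0 i).le)
    have := hh i; have := hv0 i; have := hε i
    rw [abs_of_pos (by positivity)]
    simp only [hη]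
    have : 0 ≤ h i ^ 2 + h i ^ 6 / (T i).im ^ 2 := by positivity
    linarith
  have Oηh : η =O[⊤] h := by
    refine Opt 3 (fun i => ?_) (fun i => (hh i).le)
    have h1 := hh i; have h2 := hv0 i; have h3 := hε i
    have h4 := hh1 i
    rw [abs_of_pos (hη0 i)]
    have e1 : h i ^ 2 ≤ h i := by nlinarith
    have e2 : h i ^ 6 / (T i).im ^ 2 ≤ h i := by
      rw [div_le_iff₀ (by positivity)]
      have : θ i ^ 2 ≤ (T i).im ^ 2 := pow_le_pow_left₀ (hθ0 i).le (hv i) 2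
      calc h i ^ 6 = h i * h i ^ 5 := by ring
        _ ≤ h i * (T i).im ^ 2 := by gcongr; exact (hθ5 i).trans this
    have e3 : ε i / (T i).im ≤ h i := by
      rw [div_le_iff₀ h2]
      calc ε i ≤ h i ^ 8 := hε8 i
        _ = h i ^ 4 * (h i * h i ^ 3) := by ring
        _ ≤ 1 * (h i * h i ^ 3) := by gcongr; exact pow_le_one₀ h1.le h4
        _ ≤ h i * (T i).im := by rw [one_mul]; gcongr; exact (hθ3 i).trans (hv i)
    simp only [hη]; linarith
  have Ovη : (fun i => (T i).im * η i) =O[⊤] (fun i => h i ^ 2) := by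
    refine Opt (13 + 1 + 1) (fun i => ?_) (fun i => sq_nonneg _)
    have h1 := hh i; have h2 := hv0 i; have h3 := hε i
    have h4 := hh1 i
    rw [abs_of_pos (mul_pos h2 (hη0 i))]
    have e : (T i).im * η i = (T i).im * h i ^ 2 + h i ^ 6 / (T i).im + ε i := by
      simp only [hη]; field_simp
    rw [e]
    have e1 : (T i).im * h i ^ 2 ≤ 13 * h i ^ 2 := by
      gcongr
      exact (le_abs_self _).trans ((Complex.abs_im_le_norm _).trans (hb i).1)
    have e2 : h i ^ 6 / (T i).im ≤ h i ^ 2 := by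
      rw [div_le_iff₀ h2]
      calc h i ^ 6 = h i ^ 2 * (h i * h i ^ 3) := by ring
        _ ≤ h i ^ 2 * (1 * (T i).im) := by gcongr; exact (hθ3 i).trans (hv i)
        _ = _ := by ring
    have e3 : ε i ≤ h i ^ 2 := by
      refine (hε8 i).trans (pow_le_pow_of_le_one h1.le h4 (by norm_num))
    linarith
  -- abbreviations
  set A : α → ℝ := fun i => (G i).re with hA
  set b : α → ℝ := fun i => (G i).im with hbdef
  set u : α → ℝ := fun i => (T i).re with hu
  set v : α → ℝ := fun i => (T i).im with hvdef
  set s : α → ℝ := fun i => 1 / ‖T i‖ ^ 2 with hs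
  have hsuv : ∀ i, s i * (u i ^ 2 + v i ^ 2) = 1 := fun i => by
    have : ‖T i‖ ^ 2 = u i ^ 2 + v i ^ 2 := by
      rw [← Complex.normSq_eq_norm_sq, Complex.normSq_apply]; simp only [hu, hvdef]; ring
    have h0 := ht0 i
    simp only [hs, ← this]
    field_simp
  -- kappa relations
  have O1 : (fun i => κ i - 1) =O[⊤] η := by
    have e : (fun i => κ i - 1) = fun i => κ i * h i ^ 2 - ε i / (T i).im := by
      funext i
      have h1 := (hP i).v_eq
      have h2 := hv0 i
      rw [hN] at h1
      field_simp
      linarith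
    rw [e]
    exact (O1mul Bκ Oh2η).sub Oεη
  have O2 : (fun i => κ i - (s i + 2 * (m3 * h i) * u i * s i ^ 2)) =O[⊤] η := by
    refine Opt C (fun i => ?_) (fun i => (hη0 i).le)
    have h1 := (hP i).hκe
    have h2 := hh i; have h3 := hv0 i; have h4 := hε i
    have e1 : 1 / ‖T i‖ ^ 2 * (1 + 2 * (m3 * h i) * (T i).re / ‖T i‖ ^ 2) =
        s i + 2 * (m3 * h i) * u i * s i ^ 2 := by simp only [hs, hu]; ring
    have e2 : 1 / N i + 1 / (N i ^ 3 * (T i).im ^ 2) ≤ η i := by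
      have : 1 / (N i ^ 3 * (T i).im ^ 2) = (1 / N i) ^ 3 / (T i).im ^ 2 := by
        have := hN0 i; field_simp
      rw [this, hN]
      simp only [hη]
      have : 0 ≤ ε i / (T i).im := by positivity
      rw [← pow_mul]; linarith
    rw [e1] at h1
    exact h1.trans (mul_le_mul_of_nonneg_left e2 hC)
  have O3 : (fun i => s i - 1 + 2 * (m3 * h i) * u i * s i ^ 2) =O[⊤] η := by
    have := O1.sub O2
    refine this.congr_left fun i => ?_
    ring
  have Os2 : (fun i => s i ^ 2) =O[⊤] (fun _ => (1:ℝ)) := by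
    simpa [sq] using O11 Bs Bs
  have Os1 : (fun i => s i - 1) =O[⊤] h := by
    have h1 := O3.trans Oηh
    have h2 : (fun i => 2 * m3 * (u i * s i ^ 2 * h i)) =O[⊤] h :=
      (O1mul (O11 Bu Os2) (isBigO_refl h ⊤)).const_mul_left _
    refine (h1.sub h2).congr_left fun i => ?_
    ring
  -- G vs 1/T
  have OG : ∀ i, ‖G i - (T i)⁻¹‖ ≤ (4 / c0 ^ 2) * h i ^ 2 := fun i => by
    have hT0 : T i ≠ 0 := norm_pos_iff.1 (ht0 i)
    have hG0 := (hP i).hG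
    have e : G i - (T i)⁻¹ = (G i * (T i)⁻¹) * (k i / N i) := by
      have := (hP i).F_eq
      have h2 : k i / N i = T i - (G i)⁻¹ := by rw [this]; ring
      rw [h2]; field_simp
    rw [e, norm_mul, norm_mul, norm_div, Complex.norm_real, Real.norm_of_nonneg (hN0 i).le,
      norm_inv]
    have h1 : ‖T i‖⁻¹ ≤ c0⁻¹ := inv_anti₀ hc0 (hP i).hc
    calc ‖G i‖ * ‖T i‖⁻¹ * (‖k i‖ / N i) ≤ (2 / c0) * c0⁻¹ * (2 / N i) := by
          have := (hP i).hk
          have := (hb i).2.1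
          have := hN0 i
          gcongr
      _ = (4 / c0 ^ 2) * (1 / N i) := by field_simp; norm_num
      _ = _ := by rw [hN]
  have Tre : ∀ i, ((T i)⁻¹).re = u i * s i := fun i => by
    rw [Complex.inv_re, Complex.normSq_eq_norm_sq]; simp only [hu, hs]; ring
  have Tim : ∀ i, ((T i)⁻¹).im = - (v i * s i) := fun i => by
    rw [Complex.inv_im, Complex.normSq_eq_norm_sq]; simp only [hvdef, hs]; ring
  have OA : (fun i => A i - u i * s i) =O[⊤] η := by
    refine IsBigO.trans ?_ Oh2η
    refine Opt (4 / c0 ^ 2) (fun i => ?_) (fun i => sq_nonneg _)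
    refine le_trans ?_ (OG i)
    have := Complex.abs_re_le_norm (G i - (T i)⁻¹)
    rwa [Complex.sub_re, Tre] at this
  have OB : (fun i => b i + v i * s i) =O[⊤] η := by
    refine IsBigO.trans ?_ Oh2η
    refine Opt (4 / c0 ^ 2) (fun i => ?_) (fun i => sq_nonneg _)
    refine le_trans ?_ (OG i)
    have := Complex.abs_im_le_norm (G i - (T i)⁻¹)
    rwa [Complex.sub_im, Tim, sub_neg_eq_add] at this
  -- x
  have Ox : (fun i => x i - (u i + u i * s i + m3 * h i * ((u i ^ 2 - v i ^ 2) * s i ^ 2)))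
      =O[⊤] η := by
    have hkre : (fun i => (k i).re) =O[⊤] (fun _ => (1:ℝ)) :=
      Opt1 2 fun i => (Complex.abs_re_le_norm _).trans (hP i).hk
    have h1 : (fun i => (k i).re - u i * s i - m3 * h i * ((u i ^ 2 - v i ^ 2) * s i ^ 2))
        =O[⊤] η := by
      refine Opt (C * (13 + 1) / c0 ^ 2) (fun i => ?_) (fun i => (hη0 i).le)
      have e := (hP i).hke
      have h2 := hh i; have h3 := hv0 i; have h4 := hε i
      have e1 : (k i - 1 / T i - (m3 * h i : ℝ) / T i ^ 2).re =
          (k i).re - u i * s i - m3 * h i * ((u i ^ 2 - v i ^ 2) * s i ^ 2) := by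
        rw [Complex.sub_re, Complex.sub_re, one_div, Tre, div_eq_mul_inv, Complex.re_ofReal_mul,
          ← inv_pow, sq, Complex.mul_re, Tre, Tim]
        ring
      rw [← e1]
      refine (Complex.abs_re_le_norm _).trans (e.trans ?_)
      have hc := (hP i).hc
      have hv13 : v i ≤ 13 := (le_abs_self _).trans ((Complex.abs_im_le_norm _).trans (hb i).1)
      have e2 : 1 / N i * (1 + 1 / (N i ^ 2 * (T i).im)) ≤ (13 + 1) * η i := by
        have : 1 / N i * (1 + 1 / (N i ^ 2 * (T i).im)) = h i ^ 2 +  h i ^ 6 / v i ^ 2 * v i := by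
          have h5 : 1 / (N i ^ 2 * (T i).im) = (1 / N i) ^ 2 / v i := by
            have := hN0 i; simp only [hvdef]; field_simp
          have : v i ≠ 0 := h3.ne'
          rw [h5, hN]; field_simp
        rw [this]
        have h6 : 0 ≤ h i ^ 6 / v i ^ 2 := by positivity
        have h7 : 0 ≤ ε i / v i := div_nonneg h4.le h3.le
        simp only [hη]
        nlinarith [sq_nonneg (h i), mul_le_mul_of_nonneg_left hv13 h6]
      calc C / N i * (1 + 1 / (N i ^ 2 * (T i).im)) / ‖T i‖ ^ 2
          = C * (1 / N i * (1 + 1 / (N i ^ 2 * (T i).im))) / ‖T i‖ ^ 2 := by ring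
        _ ≤ C * ((13 + 1) * η i) / c0 ^ 2 := by
          have := (hη0 i).le
          gcongr
        _ = _ := by ring
    have h2 : (fun i => (k i).re * h i ^ 2) =O[⊤] η := O1mul hkre Oh2η
    refine (h1.sub h2).congr_left fun i => ?_
    have e := congrArg Complex.re (hP i).hz2
    rw [show (1 - 1 / (N i : ℂ)) = ((1 - 1 / N i : ℝ) : ℂ) by push_cast; rfl, hN, Complex.add_re,
      Complex.add_re, Complex.re_ofReal_mul, Complex.re_ofReal_mul] at e
    simp at e
    rw [e]
    simp only [hu]; ring
  -- main
  have Oa : (fun i => m3 * h i) =O[⊤] h := (isBigO_refl h ⊤).const_mul_left _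
  have Oa1 := Oa.trans Oh1
  have hhη : (fun i => h i * h i) =O[⊤] η := by simpa [sq] using Oh2η
  have Ous : (fun i => u i * s i) =O[⊤] (fun _ => (1:ℝ)) := O11 Bu Bs
  have OA2 : (fun i => A i ^ 2 - (u i * s i) ^ 2) =O[⊤] η := by
    refine (O1mul (BA.add Ous) OA).congr_left fun i => ?_
    simp only [hA]; ring
  have OE : (fun i => (2 * A i - x i) - m3 * h i * (1 - 4 * A i ^ 2)) =O[⊤] η := by
    -- pieces
    have p1 := OA.const_mul_left 2
    have p2 := O1mul Bu O3
    have p3 : (fun i => m3 * h i * (s i - 1)) =O[⊤] η := (Oa.mul Os1).trans hhη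
    have p4 : (fun i => m3 * h i * (4 * (A i ^ 2 - (u i * s i) ^ 2))) =O[⊤] η :=
      O1mul Oa1 (OA2.const_mul_left 4)
    refine ((((p1.sub Ox).add p2).add p3).add p4).congr_left fun i => ?_
    have e := hsuv i
    have e2 : v i ^ 2 * s i ^ 2 = s i - u i ^ 2 * s i ^ 2 := by linear_combination (s i) * e
    linear_combination (-(m3 * h i)) * e2
  have Ow : (fun i => A i ^ 2 + b i ^ 2 - 1) =O[⊤] h := by
    have Ovs : (fun i => v i * s i) =O[⊤] (fun _ => (1:ℝ)) := O11 Bv Bs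
    have q1 := (O1mul (BB.sub Ovs) OB).trans Oηh
    refine (((OA2.trans Oηh).add q1).add Os1).congr_left fun i => ?_
    have e := hsuv i
    linear_combination (-(s i)) * e
  have BA2 : (fun i => A i ^ 2) =O[⊤] (fun _ => (1:ℝ)) := by simpa [sq] using O11 BA BA
  have BB2 : (fun i => b i ^ 2) =O[⊤] (fun _ => (1:ℝ)) := by simpa [sq] using O11 BB BB
  have c1 : (fun _ : α => (1:ℝ)) =O[⊤] (fun _ => (1:ℝ)) := isBigO_refl _ _
  have OQ : (fun i => (1 + 3 * A i ^ 2 - b i ^ 2 + 5 * A i ^ 4 - 10 * A i ^ 2 * b i ^ 2 + b i ^ 4)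
      - (4 * A i ^ 2 - 1) ^ 2) =O[⊤] h := by
    have q : (fun i => (- 1 * 1 - 10 * A i ^ 2 + 2 * (1 - A i ^ 2) + (A i ^ 2 + b i ^ 2 - 1)))
        =O[⊤] (fun _ => (1:ℝ)) :=
      (((c1.const_mul_left (-1)).sub (BA2.const_mul_left 10)).add ((c1.sub BA2).const_mul_left 2)).add
        ((BA2.add BB2).sub c1)
    refine (O1mul q Ow).congr_left fun i => ?_
    ring
  have OD : (fun i => (2 * A i - x i) ^ 2 - (m3 * h i) ^ 2 * (1 + 3 * A i ^ 2 - b i ^ 2 + 5 * A i ^ 4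
      - 10 * A i ^ 2 * b i ^ 2 + b i ^ 4)) =O[⊤] (fun i => h i * η i + h i * (h i * h i)) := by
    have hp1 : (fun i => h i * η i) =O[⊤] (fun i => h i * η i + h i * (h i * h i)) := by
      refine Opt 1 (fun i => ?_) (fun i => ?_) <;> have h1 := hh i <;> have h2 := hη0 i
      · rw [abs_of_pos (by positivity)]
        have : 0 < h i * (h i * h i) := by positivity
        linarith
      · positivity
    have hp2 : (fun i => h i * (h i * h i)) =O[⊤] (fun i => h i * η i + h i * (h i * h i)) := by
      refine Opt 1 (fun i => ?_) (fun i => ?_) <;> have h1 := hh i <;> have h2 := hη0 i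
      · rw [abs_of_pos (by positivity)]
        have : 0 < h i * η i := by positivity
        linarith
      · positivity
    have r0 : (fun i => (1 - 4 * A i ^ 2)) =O[⊤] (fun _ => (1:ℝ)) := c1.sub (BA2.const_mul_left 4)
    have r1 : (fun i => (1 - 4 * A i ^ 2) * (m3 * h i)) =O[⊤] h := O1mul r0 Oa
    have r2 := (((OE.trans Oηh).add (r1.const_mul_left 2)).mul OE).trans hp1
    have r3 := (Oa.mul (Oa.mul OQ)).trans hp2
    refine (r2.sub r3).congr_left fun i => ?_
    ring
  refine (BG.mul OD).trans ?_
  have f1 : (fun i => h i * (v i * η i)) =O[⊤] (fun i => h i * h i ^ 2) := (isBigO_refl h ⊤).mul Ovη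
  have f2 : (fun i => v i * (h i * h i ^ 2)) =O[⊤] (fun i => h i * h i ^ 2) :=
    O1mul Bv (isBigO_refl _ _)
  refine (f1.add f2).congr (fun i => ?_) (fun i => ?_)
  · simp only [hvdef]; ring
  · ring

def LL (a : ℝ) (k G : ℂ) : ℂ :=
  (k - G) - G + G * (k - G) ^ 2 + G ^ 3 / 3 - (a : ℂ) ^ 2 * (G + G ^ 3 + G ^ 5)

lemma cpow_im2 (G : ℂ) : (G ^ 2).re = G.re ^ 2 - G.im ^ 2 ∧ (G ^ 2).im = 2 * G.re * G.im := by
  constructor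
  · rw [sq, Complex.mul_re]; ring
  · rw [sq, Complex.mul_im]; ring

lemma cpow_im3 (G : ℂ) : (G ^ 3).re = G.re ^ 3 - 3 * G.re * G.im ^ 2 ∧
    (G ^ 3).im = 3 * G.re ^ 2 * G.im - G.im ^ 3 := by
  obtain ⟨h1, h2⟩ := cpow_im2 G
  constructor
  · rw [pow_succ, Complex.mul_re, h1, h2]; ring
  · rw [pow_succ, Complex.mul_im, h1, h2]; ring

lemma cpow_im5 (G : ℂ) :
    (G ^ 5).im = 5 * G.re ^ 4 * G.im - 10 * G.re ^ 2 * G.im ^ 3 + G.im ^ 5 := by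
  obtain ⟨h1, h2⟩ := cpow_im2 G
  obtain ⟨h3, h4⟩ := cpow_im3 G
  rw [show G ^ 5 = G ^ 3 * G ^ 2 by ring, Complex.mul_im, h1, h2, h3, h4]; ring

lemma LL_im {a x ε : ℝ} {k G : ℂ} (hG : G ≠ 0) (hz : (x : ℂ) + ε * I = G⁻¹ + k) :
    (4 / 3) * (- G.im) ^ 3 - (LL a k G).im =
      - (G.im * ((2 * G.re - x) ^ 2 - a ^ 2 * (1 + 3 * G.re ^ 2 - G.im ^ 2 + 5 * G.re ^ 4
        - 10 * G.re ^ 2 * G.im ^ 2 + G.im ^ 4)))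
      + ε * (2 * G.re ^ 2 - 2 * G.im ^ 2 - 2 * x * G.re + 1) + ε ^ 2 * G.im := by
  have hk : k = (x : ℂ) + ε * I - G⁻¹ := by rw [hz]; ring
  have e : LL a k G = ((4 / 3 : ℝ) : ℂ) * G ^ 3 - ((2 : ℝ) : ℂ) * (((x : ℂ) + ε * I) * G ^ 2) +
      ((x : ℂ) + ε * I) ^ 2 * G - ((x : ℂ) + ε * I) - ((a ^ 2 : ℝ) : ℂ) * (G + G ^ 3 + G ^ 5) := by
    rw [LL, hk]; push_cast; field_simp; ring
  obtain ⟨h1, h2⟩ := cpow_im2 G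
  obtain ⟨h3, h4⟩ := cpow_im3 G
  have h5 := cpow_im5 G
  obtain ⟨h6, h7⟩ := cpow_im2 ((x : ℂ) + ε * I)
  have z1 : ((x : ℂ) + ε * I).re = x := by simp
  have z2 : ((x : ℂ) + ε * I).im = ε := by simp
  rw [e]
  generalize ((x : ℂ) + ε * I) = z at *
  simp only [Complex.sub_im, Complex.add_im, Complex.im_ofReal_mul, Complex.mul_im z,
    Complex.mul_im (z ^ 2), h1, h2, h4, h5, h6, h7, z1, z2]
  ring

structure Cfg where
  N : ℝ
  h : ℝ
  ε : ℝ
  x : ℝ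
  θ : ℝ
  κ : ℝ
  T : ℂ
  k : ℂ
  G : ℂ

lemma near_exists (C c0 m3 : ℝ) (hC : 0 ≤ C) (hc0 : 0 < c0) :
    ∃ C' : ℝ, 0 ≤ C' ∧ ∀ (N h ε x θ κ : ℝ) (T k G : ℂ),
      Pt C c0 (m3 * h) N (x + ε * I) T k G κ → 1 / N = h ^ 2 → 2 ≤ N → 4 / c0 ≤ N →
      0 < h → 0 < ε → ε ≤ h ^ 8 → |x| ≤ 10 → 0 < θ → h ^ 5 ≤ θ ^ 2 → h ^ 3 ≤ θ →
      θ ≤ T.im →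
      |G.im * ((2 * G.re - x) ^ 2 - (m3 * h) ^ 2 * (1 + 3 * G.re ^ 2 - G.im ^ 2 + 5 * G.re ^ 4
        - 10 * G.re ^ 2 * G.im ^ 2 + G.im ^ 4))| ≤ C' * h ^ 3 := by
  let S : Set Cfg := {c | Pt C c0 (m3 * c.h) c.N (c.x + c.ε * I) c.T c.k c.G c.κ ∧
    1 / c.N = c.h ^ 2 ∧ 2 ≤ c.N ∧ 4 / c0 ≤ c.N ∧ 0 < c.h ∧ 0 < c.ε ∧ c.ε ≤ c.h ^ 8 ∧ |c.x| ≤ 10 ∧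
    0 < c.θ ∧ c.h ^ 5 ≤ c.θ ^ 2 ∧ c.h ^ 3 ≤ c.θ ∧ c.θ ≤ c.T.im}
  have := near_main (α := S) (fun c => c.1.N) (fun c => c.1.h) (fun c => c.1.ε) (fun c => c.1.x)
    (fun c => c.1.θ) (fun c => c.1.κ) (fun c => c.1.T) (fun c => c.1.k) (fun c => c.1.G) C c0 m3 hC
    hc0 (fun c => c.2.1) (fun c => c.2.2.1) (fun c => c.2.2.2.1) (fun c => c.2.2.2.2.1)
    (fun c => c.2.2.2.2.2.1) (fun c => c.2.2.2.2.2.2.1) (fun c => c.2.2.2.2.2.2.2.1)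
    (fun c => c.2.2.2.2.2.2.2.2.1) (fun c => c.2.2.2.2.2.2.2.2.2.2.2.2)
    (fun c => c.2.2.2.2.2.2.2.2.2.1) (fun c => c.2.2.2.2.2.2.2.2.2.2.1)
    (fun c => c.2.2.2.2.2.2.2.2.2.2.2.1)
  obtain ⟨c, hc⟩ := Asymptotics.isBigO_top.1 this
  refine ⟨|c|, abs_nonneg c, fun N h ε x θ κ T k G a1 a2 a3 a4 a5 a6 a7 a8 a9 a10 a11 a12 => ?_⟩
  have := hc ⟨⟨N, h, ε, x, θ, κ, T, k, G⟩, a1, a2, a3, a4, a5, a6, a7, a8, a9, a10, a11, a12⟩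
  rw [Real.norm_eq_abs, Real.norm_of_nonneg (by positivity)] at this
  exact this.trans (mul_le_mul_of_nonneg_right (le_abs_self c) (by positivity))

set_option maxHeartbeats 800000 in
lemma near_all (C c0 m3 : ℝ) (hC : 0 ≤ C) (hc0 : 0 < c0) :
    ∃ C' : ℝ, 0 ≤ C' ∧ ∀ (N h ε x θ κ : ℝ) (T k G : ℂ),
      Pt C c0 (m3 * h) N (x + ε * I) T k G κ → 1 / N = h ^ 2 → 2 ≤ N → 4 / c0 ≤ N →
      0 < h → h ≤ 1 → 0 < ε → ε ≤ h ^ 8 → |x| ≤ 10 → 0 < θ → h ^ 5 ≤ θ ^ 2 → h ^ 3 ≤ θ →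
      |(4 / 3) * (- G.im) ^ 3 - (LL (m3 * h) k G).im| ≤ C' * θ := by
  obtain ⟨C1, hC1, hmain⟩ := near_exists C c0 m3 hC hc0
  set g := 2 / c0 with hg
  have hg0 : 0 < g := by positivity
  set Q := (2 * g + 10) ^ 2 + m3 ^ 2 * (1 + 3 * g ^ 2 + g ^ 2 + 5 * g ^ 4 + 10 * g ^ 2 * g ^ 2
    + g ^ 4) with hQ
  have hQ0 : 0 ≤ Q := by positivity
  refine ⟨C1 + 2 * g ^ 2 * Q + (2 * g ^ 2 + 2 * g ^ 2 + 2 * 10 * g + 1) + g, by positivity, ?_⟩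
  intro N h ε x θ κ T k G a1 a2 a3 a4 a5 a5' a6 a7 a8 a9 a10 a11
  have hε3 : ε ≤ h ^ 3 := a7.trans (pow_le_pow_of_le_one a5.le a5' (by norm_num))
  have hε1 : ε ≤ 1 := hε3.trans (pow_le_one₀ a5.le a5')
  obtain ⟨b1, b2, b3, b4⟩ := a1.near hc0 a3 a4 a6 hε1 a8
  have hA : |G.re| ≤ g := (Complex.abs_re_le_norm _).trans b2
  have hB : |G.im| ≤ g := (Complex.abs_im_le_norm _).trans b2
  have hεθ : ε ≤ θ := hε3.trans a11
  rw [LL_im a1.hG a1.hz1]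
  have t1 : |G.im * ((2 * G.re - x) ^ 2 - (m3 * h) ^ 2 * (1 + 3 * G.re ^ 2 - G.im ^ 2 + 5 * G.re ^ 4
        - 10 * G.re ^ 2 * G.im ^ 2 + G.im ^ 4))| ≤ (C1 + 2 * g ^ 2 * Q) * θ := by
    rcases le_total θ T.im with hv | hv
    · have := hmain N h ε x θ κ T k G a1 a2 a3 a4 a5 a6 a7 a8 a9 a10 a11 hv
      have h2 : C1 * h ^ 3 ≤ C1 * θ := by gcongr
      have h3 : 0 ≤ 2 * g ^ 2 * Q * θ := by positivity
      linarith
    · have h1 : |G.im| ≤ 2 * g ^ 2 * θ := by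
        rw [abs_of_neg a1.hG_im]
        exact b4.trans (by gcongr)
      have h2 : |(2 * G.re - x) ^ 2 - (m3 * h) ^ 2 * (1 + 3 * G.re ^ 2 - G.im ^ 2 + 5 * G.re ^ 4
        - 10 * G.re ^ 2 * G.im ^ 2 + G.im ^ 4)| ≤ Q := by
        have e1 : |2 * G.re - x| ≤ 2 * g + 10 := by
          rw [abs_le] at *; constructor <;> linarith [hA.1, hA.2, a8.1, a8.2]
        have e2 : |1 + 3 * G.re ^ 2 - G.im ^ 2 + 5 * G.re ^ 4
            - 10 * G.re ^ 2 * G.im ^ 2 + G.im ^ 4| ≤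
            1 + 3 * g ^ 2 + g ^ 2 + 5 * g ^ 4 + 10 * g ^ 2 * g ^ 2 + g ^ 4 := by
          have f1 : G.re ^ 2 ≤ g ^ 2 := by rw [← sq_abs]; gcongr
          have f2 : G.im ^ 2 ≤ g ^ 2 := by rw [← sq_abs]; gcongr
          have f3 : G.re ^ 4 ≤ g ^ 4 := by
            rw [show G.re ^ 4 = |G.re| ^ 4 by rw [← abs_pow, abs_of_nonneg (by positivity)]]
            gcongr
          have f4 : G.im ^ 4 ≤ g ^ 4 := by
            rw [show G.im ^ 4 = |G.im| ^ 4 by rw [← abs_pow, abs_of_nonneg (by positivity)]]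
            gcongr
          have f5 : G.re ^ 2 * G.im ^ 2 ≤ g ^ 2 * g ^ 2 := by gcongr
          have p1 := sq_nonneg G.re
          have p2 := sq_nonneg G.im
          have p3 : 0 ≤ G.re ^ 4 := by positivity
          have p4 : 0 ≤ G.im ^ 4 := by positivity
          have p5 := mul_nonneg p1 p2
          rw [abs_le]; constructor <;> linarith
        refine (abs_sub _ _).trans ?_
        rw [abs_pow, abs_mul, abs_pow, abs_mul, abs_of_pos a5, hQ]
        have e3 : (|m3| * h) ^ 2 ≤ m3 ^ 2 := by
          rw [← sq_abs m3]
          have : |m3| * h ≤ |m3| := mul_le_of_le_one_right (abs_nonneg _) a5'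
          gcongr
        gcongr
      rw [abs_mul]
      calc _ ≤ (2 * g ^ 2 * θ) * Q := by gcongr
        _ ≤ _ := by nlinarith [mul_nonneg hC1 a9.le]
  have t2 : |ε * (2 * G.re ^ 2 - 2 * G.im ^ 2 - 2 * x * G.re + 1)| ≤
      (2 * g ^ 2 + 2 * g ^ 2 + 2 * 10 * g + 1) * θ := by
    rw [abs_mul, abs_of_pos a6, mul_comm]
    have f1 : G.re ^ 2 ≤ g ^ 2 := by rw [← sq_abs]; gcongr
    have f2 : G.im ^ 2 ≤ g ^ 2 := by rw [← sq_abs]; gcongr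
    have f3 : |x * G.re| ≤ 10 * g := by rw [abs_mul]; gcongr
    have f4 := abs_le.1 f3
    have : |2 * G.re ^ 2 - 2 * G.im ^ 2 - 2 * x * G.re + 1| ≤
        2 * g ^ 2 + 2 * g ^ 2 + 2 * 10 * g + 1 := by
      have p1 := sq_nonneg G.re
      have p2 := sq_nonneg G.im
      rw [abs_le]; constructor <;> linarith [f4.1, f4.2]
    gcongr
  have t3 : |ε ^ 2 * G.im| ≤ g * θ := by
    rw [abs_mul, abs_of_pos (by positivity), mul_comm]
    have : ε ^ 2 ≤ θ := by nlinarith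
    gcongr
  have := abs_add_le (-(G.im * ((2 * G.re - x) ^ 2 - (m3 * h) ^ 2 * (1 + 3 * G.re ^ 2 - G.im ^ 2 + 5 * G.re ^ 4
        - 10 * G.re ^ 2 * G.im ^ 2 + G.im ^ 4))) + ε * (2 * G.re ^ 2 - 2 * G.im ^ 2 - 2 * x * G.re + 1)) (ε ^ 2 * G.im)
  have h4 := abs_add_le (-(G.im * ((2 * G.re - x) ^ 2 - (m3 * h) ^ 2 * (1 + 3 * G.re ^ 2 - G.im ^ 2 + 5 * G.re ^ 4
        - 10 * G.re ^ 2 * G.im ^ 2 + G.im ^ 4)))) (ε * (2 * G.re ^ 2 - 2 * G.im ^ 2 - 2 * x * G.re + 1))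
  rw [abs_neg] at h4
  linarith

lemma im_mul_le (p q : ℂ) : |(p * q).im| ≤ |p.im| * ‖q‖ + ‖p‖ * |q.im| := by
  rw [Complex.mul_im]
  refine (abs_add_le _ _).trans ?_
  rw [abs_mul, abs_mul, add_comm]
  have := Complex.abs_re_le_norm p
  have := Complex.abs_re_le_norm q
  gcongr

lemma LL_far {a : ℝ} {k G : ℂ} (hG : ‖G‖ ≤ 1) (hk : ‖k‖ ≤ 2) :
    |(4 / 3) * (- G.im) ^ 3 - (LL a k G).im| ≤ (20 + 9 * a ^ 2) * (|G.im| + |k.im|) := by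
  set B := |G.im| with hB
  have hB0 : 0 ≤ B := abs_nonneg _
  have hB1 : B ≤ 1 := (Complex.abs_im_le_norm _).trans hG
  have hk0 : 0 ≤ |k.im| := abs_nonneg _
  have g2 : ‖G ^ 2‖ ≤ 1 := by rw [norm_pow]; exact pow_le_one₀ (norm_nonneg _) hG
  have g3 : ‖G ^ 3‖ ≤ 1 := by rw [norm_pow]; exact pow_le_one₀ (norm_nonneg _) hG
  have i2 : |(G ^ 2).im| ≤ 2 * B := by
    have := im_mul_le G G
    rw [sq]; nlinarith
  have i3 : |(G ^ 3).im| ≤ 3 * B := by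
    have := im_mul_le (G ^ 2) G
    rw [show G ^ 3 = G ^ 2 * G by ring]
    nlinarith [norm_nonneg G, norm_nonneg (G ^ 2), abs_nonneg (G ^ 2).im]
  have i5 : |(G ^ 5).im| ≤ 5 * B := by
    have := im_mul_le (G ^ 3) (G ^ 2)
    rw [show G ^ 5 = G ^ 3 * G ^ 2 by ring]
    nlinarith [norm_nonneg (G ^ 3), norm_nonneg (G ^ 2), abs_nonneg (G ^ 2).im, abs_nonneg (G ^ 3).im]
  have iD : |(k - G).im| ≤ |k.im| + B := by rw [Complex.sub_im]; exact abs_sub _ _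
  have nD : ‖k - G‖ ≤ 3 := (norm_sub_le _ _).trans (by linarith)
  have iD2 : |((k - G) ^ 2).im| ≤ 6 * (|k.im| + B) := by
    have := im_mul_le (k - G) (k - G)
    rw [sq]
    nlinarith [norm_nonneg (k - G), abs_nonneg (k - G).im]
  have nD2 : ‖(k - G) ^ 2‖ ≤ 9 := by
    rw [norm_pow]; nlinarith [norm_nonneg (k - G)]
  have iGD : |(G * (k - G) ^ 2).im| ≤ 9 * B + 6 * (|k.im| + B) := by
    have := im_mul_le G ((k - G) ^ 2)
    nlinarith [norm_nonneg G, norm_nonneg ((k - G) ^ 2), abs_nonneg ((k - G) ^ 2).im]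
  have e : (LL a k G).im = (k - G).im - G.im + (G * (k - G) ^ 2).im + (G ^ 3).im / 3
      - a ^ 2 * (G.im + (G ^ 3).im + (G ^ 5).im) := by
    rw [LL, ← Complex.ofReal_pow]
    simp only [Complex.sub_im, Complex.add_im, Complex.im_ofReal_mul]
    congr 2
    rw [show (3 : ℂ) = ((3 : ℝ) : ℂ) by norm_num, Complex.div_ofReal_im]
  have iS : |G.im + (G ^ 3).im + (G ^ 5).im| ≤ 9 * B := by
    refine (abs_add_three _ _ _).trans ?_
    linarith
  have iS2 : |a ^ 2 * (G.im + (G ^ 3).im + (G ^ 5).im)| ≤ a ^ 2 * (9 * B) := by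
    rw [abs_mul, abs_of_nonneg (sq_nonneg a)]; gcongr
  have iB : |(4 / 3) * (- G.im) ^ 3| ≤ 4 / 3 * B := by
    rw [abs_mul, abs_pow, abs_neg, ← hB, abs_of_pos (by norm_num)]
    have : B ^ 3 ≤ B := by nlinarith [sq_nonneg B, mul_nonneg hB0 hB0]
    gcongr
  rw [e]
  have hBd : |G.im| ≤ B := le_rfl
  have ha := sq_nonneg a
  have hak := mul_nonneg ha hk0
  rw [abs_le] at *
  constructor <;> nlinarith [iD.1, iD.2, iGD.1, iGD.2, i3.1, i3.2, iS2.1, iS2.2, iB.1, iB.2, hBd.1, hBd.2]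

lemma far_δ {δ v ε t K C h : ℝ} (ht : 8 ≤ t) (hv : v = ε + δ) (hv0 : 0 < v) (hδ : 0 ≤ δ)
    (hε : 0 < ε) (hC : 0 ≤ C) (hh : 0 < h) (hK : K = C + 4)
    (hm : δ * v ≤ 6 * v ^ 2 / t ^ 2 + 3 / 2 * C * h ^ 6 / t ^ 6) :
    δ ≤ 14 * ε / t ^ 2 + K * h ^ 3 / t ^ 3 := by
  by_contra! hcon
  have ht0 : 0 < t := by linarith
  have p1 : 0 ≤ K * h ^ 3 / t ^ 3 := by rw [hK]; positivity
  have p2 : 0 ≤ 14 * ε / t ^ 2 := by positivity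
  have h1 : 6 / t ^ 2 ≤ 1 / 8 := by
    rw [div_le_div_iff₀ (by positivity) (by norm_num)]; nlinarith
  have h2 : 14 * ε / t ^ 2 ≤ δ := by linarith
  have h3 : (K * h ^ 3 / t ^ 3) ^ 2 < δ ^ 2 := by
    apply pow_lt_pow_left₀ (by linarith) p1 (by norm_num)
  have e1 : 6 * v ^ 2 / t ^ 2 = 3 / 7 * (14 * ε / t ^ 2) * v + 6 / t ^ 2 * (δ * v) := by
    rw [hv]; ring
  have hδv : 0 ≤ δ * v := by positivity
  have e2 : 3 / 7 * (14 * ε / t ^ 2) * v ≤ 3 / 7 * (δ * v) := by nlinarith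
  have e3 : 6 / t ^ 2 * (δ * v) ≤ 1 / 8 * (δ * v) := by gcongr
  have e4 : δ ^ 2 ≤ δ * v := by nlinarith
  have e5 : (K * h ^ 3 / t ^ 3) ^ 2 = K ^ 2 * (h ^ 6 / t ^ 6) := by
    field_simp
  have e6 : 3 / 2 * C * h ^ 6 / t ^ 6 = 3 / 2 * C * (h ^ 6 / t ^ 6) := by ring
  have e7 : 0 < h ^ 6 / t ^ 6 := by positivity
  have e8 : 15 / 4 * C ≤ K ^ 2 := by rw [hK]; nlinarith
  have e9 := mul_le_mul_of_nonneg_right e8 e7.le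
  rw [e5] at h3
  rw [e1, e6] at hm
  nlinarith

set_option maxHeartbeats 800000 in
lemma far_all (C c0 m3 : ℝ) (hC : 0 ≤ C) :
    ∃ C' : ℝ, 0 ≤ C' ∧ ∀ (N h ε x θ κ : ℝ) (T k G : ℂ),
      Pt C c0 (m3 * h) N (x + ε * I) T k G κ → 1 / N = h ^ 2 → 2 ≤ N →
      0 < h → h ≤ 1 → 0 < ε → ε ≤ h ^ 8 → 10 ≤ |x| → h ^ 3 ≤ θ →
      |(4 / 3) * (- G.im) ^ 3 - (LL (m3 * h) k G).im| ≤ C' * θ / (1 + x ^ 2) := by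
  set K := C + 4 with hK
  refine ⟨(20 + 9 * m3 ^ 2) * (2 * (5 * (15 + K) + 4 * (14 + K))), by positivity, ?_⟩
  intro N h ε x θ κ T k G a1 a2 a3 a5 a5' a6 a7 a8 a11
  have hε3 : ε ≤ h ^ 3 := a7.trans (pow_le_pow_of_le_one a5.le a5' (by norm_num))
  have hN0 : 0 < N := by linarith
  have h1 := a1.T_close (by linarith)
  have h2 := a1.F_close hN0
  have e2 : 2 / N ≤ 1 := by rw [div_le_one (by linarith)]; exact a3
  have hzx : |x| ≤ ‖(x : ℂ) + ε * I‖ := by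
    have := Complex.abs_re_le_norm ((x : ℂ) + ε * I)
    simpa using this
  have ht : |x| - 2 ≤ ‖T‖ := by
    have := norm_sub_norm_le ((x : ℂ) + ε * I) T
    rw [norm_sub_rev] at this
    linarith
  set t := ‖T‖ with htdef
  have ht8 : 8 ≤ t := by linarith
  have ht0 : 0 < t := by linarith
  have htx : 4 / 5 * |x| ≤ t := by linarith
  have h3 := abs_le.1 h2
  have hGp : 0 < ‖G‖ := norm_pos_iff.2 a1.hG
  set f := ‖G‖⁻¹ with hf
  have hf1 : f ≤ 9 / 8 * t := by linarith [h3.2]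
  have hf2 : 7 / 10 * |x| ≤ f := by linarith [h3.1]
  have hf7 : 7 ≤ f := by linarith
  have hGf : ‖G‖ = f⁻¹ := by rw [hf, inv_inv]
  have hG1 : ‖G‖ ≤ 1 := by rw [hGf]; exact inv_le_one_of_one_le₀ (by linarith)
  set v := T.im with hv
  have hv0 : 0 < v := a1.hT
  have hveq := a1.v_eq
  have hκ0 := a1.hκ0
  have hκv : 0 ≤ κ * v := by positivity
  have hNinv : 1 / N ≤ 1 / 2 := by gcongr
  have hNinv0 : 0 < 1 / N := by positivity
  rw [← hv] at hveq
  have hδ1 : v - ε ≤ κ * v := by rw [hveq]; nlinarith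
  have hδ2 : κ * v ≤ 2 * (v - ε) := by rw [hveq]; nlinarith
  have hδ0 : 0 ≤ v - ε := by linarith
  have hx2 : 0 < x ^ 2 := by rw [← sq_abs]; nlinarith
  have hδ : v - ε ≤ 14 * ε / t ^ 2 + K * h ^ 3 / t ^ 3 := by
    refine far_δ (v := v) ht8 (by ring) hv0 hδ0 a6 hC a5 hK ?_
    have hu := a1.hκu
    rw [norm_inv, ← hf, ← hv, ← htdef] at hu
    have hf3 : f ^ 2 ≤ 3 / 2 * t ^ 2 := by nlinarith
    calc (v - ε) * v ≤ κ * v * v := by gcongr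
      _ = κ * v ^ 2 := by ring
      _ ≤ (f ^ 2 * (4 / t ^ 4 + C / (N ^ 3 * t ^ 8 * v ^ 2))) * v ^ 2 := by gcongr
      _ ≤ (3 / 2 * t ^ 2 * (4 / t ^ 4 + C / (N ^ 3 * t ^ 8 * v ^ 2))) * v ^ 2 := by gcongr
      _ = 6 * v ^ 2 / t ^ 2 + 3 / 2 * C * (1 / N) ^ 3 / t ^ 6 := by field_simp; ring
      _ = _ := by rw [a2]; ring
  have hh3 : 0 < h ^ 3 := by positivity
  have hδ3 : v - ε ≤ (14 + K) * h ^ 3 / t ^ 2 := by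
    refine hδ.trans ?_
    have : K * h ^ 3 / t ^ 3 ≤ K * h ^ 3 / t ^ 2 := by
      apply div_le_div_of_nonneg_left (by positivity) (by positivity)
      exact pow_le_pow_right₀ (by linarith) (by norm_num)
    have h6 : 14 * ε / t ^ 2 ≤ 14 * h ^ 3 / t ^ 2 := by gcongr
    calc _ ≤ 14 * h ^ 3 / t ^ 2 + K * h ^ 3 / t ^ 2 := by linarith
      _ = _ := by ring
  have ht2x : x ^ 2 / 2 ≤ t ^ 2 := by
    have := pow_le_pow_left₀ (by positivity) htx 2
    rw [mul_pow, sq_abs] at this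
    linarith
  have hδ4 : v - ε ≤ 2 * (14 + K) * h ^ 3 / x ^ 2 := by
    refine hδ3.trans ?_
    calc (14 + K) * h ^ 3 / t ^ 2 ≤ (14 + K) * h ^ 3 / (x ^ 2 / 2) := by gcongr
      _ = _ := by field_simp
  have hv1 : v ≤ (15 + K) * h ^ 3 := by
    have : (14 + K) * h ^ 3 / t ^ 2 ≤ (14 + K) * h ^ 3 := by
      apply div_le_self (by positivity)
      exact one_le_pow₀ (by linarith)
    linarith
  have hB : |G.im| ≤ 5 * (15 + K) * h ^ 3 / x ^ 2 := by
    rw [abs_of_neg a1.hG_im, a1.B_eq, ← hv]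
    have hκN : κ / N ≤ 1 := by
      rw [div_le_one (by linarith)]; linarith [a1.hκ2]
    have hG2 : ‖G‖ ^ 2 ≤ 5 / 2 / x ^ 2 := by
      rw [hGf, inv_pow, inv_eq_one_div, div_le_div_iff₀ (by positivity) hx2]
      have := pow_le_pow_left₀ (by positivity) hf2 2
      rw [mul_pow, sq_abs] at this
      linarith
    calc v * (1 + κ / N) * ‖G‖ ^ 2 ≤ ((15 + K) * h ^ 3) * (1 + 1) * (5 / 2 / x ^ 2) := by gcongr
      _ = _ := by ring
  have hkim : |k.im| ≤ 4 * (14 + K) * h ^ 3 / x ^ 2 := by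
    rw [a1.hkim, ← hv, neg_mul, abs_neg, abs_of_nonneg hκv]
    calc κ * v ≤ 2 * (v - ε) := hδ2
      _ ≤ 2 * (2 * (14 + K) * h ^ 3 / x ^ 2) := by gcongr
      _ = _ := by ring
  refine (LL_far hG1 a1.hk).trans ?_
  have hm : (m3 * h) ^ 2 ≤ m3 ^ 2 := by
    rw [mul_pow]
    exact mul_le_of_le_one_right (sq_nonneg _) (pow_le_one₀ a5.le a5')
  have hx1 : 1 / x ^ 2 ≤ 2 / (1 + x ^ 2) := by
    rw [div_le_div_iff₀ hx2 (by positivity)]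
    have : 1 ≤ x ^ 2 := by rw [← sq_abs]; nlinarith
    linarith
  calc (20 + 9 * (m3 * h) ^ 2) * (|G.im| + |k.im|) ≤ (20 + 9 * m3 ^ 2) *
        (5 * (15 + K) * h ^ 3 / x ^ 2 + 4 * (14 + K) * h ^ 3 / x ^ 2) := by gcongr
    _ = (20 + 9 * m3 ^ 2) * (5 * (15 + K) + 4 * (14 + K)) * h ^ 3 * (1 / x ^ 2) := by ring
    _ ≤ (20 + 9 * m3 ^ 2) * (5 * (15 + K) + 4 * (14 + K)) * θ * (2 / (1 + x ^ 2)) := by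
        have hθ0 : 0 ≤ θ := hh3.le.trans a11
        gcongr
    _ = _ := by ring

lemma point_all (C c0 m3 : ℝ) (hC : 0 ≤ C) (hc0 : 0 < c0) :
    ∃ C' : ℝ, 0 ≤ C' ∧ ∀ (N h ε x θ κ : ℝ) (T k G : ℂ),
      Pt C c0 (m3 * h) N (x + ε * I) T k G κ → 1 / N = h ^ 2 → 2 ≤ N → 4 / c0 ≤ N →
      0 < h → h ≤ 1 → 0 < ε → ε ≤ h ^ 8 → 0 < θ → h ^ 5 ≤ θ ^ 2 → h ^ 3 ≤ θ →
      |(4 / 3) * (- G.im) ^ 3 - (LL (m3 * h) k G).im| ≤ C' * θ * (1 + x ^ 2)⁻¹ := by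
  obtain ⟨C1, hC1, h1⟩ := near_all C c0 m3 hC hc0
  obtain ⟨C2, hC2, h2⟩ := far_all C c0 m3 hC
  refine ⟨101 * C1 + C2, by positivity, ?_⟩
  intro N h ε x θ κ T k G a1 a2 a3 a4 a5 a5' a6 a7 a9 a10 a11
  have hx : 0 < 1 + x ^ 2 := by positivity
  rw [← div_eq_mul_inv]
  rcases le_total |x| 10 with hx10 | hx10
  · refine (h1 N h ε x θ κ T k G a1 a2 a3 a4 a5 a5' a6 a7 hx10 a9 a10 a11).trans ?_
    rw [le_div_iff₀ hx]
    have : x ^ 2 ≤ 100 := by rw [← sq_abs]; nlinarith [abs_nonneg x]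
    calc C1 * θ * (1 + x ^ 2) ≤ C1 * θ * (1 + 100) := by gcongr
      _ ≤ _ := by nlinarith [mul_nonneg hC2 a9.le]
  · refine (h2 N h ε x θ κ T k G a1 a2 a3 a5 a5' a6 a7 hx10 a11).trans ?_
    gcongr
    linarith

lemma cauchy_diff (μ : Measure ℝ) [IsProbabilityMeasure μ] {z : ℂ} (hz : 0 < z.im) :
    DifferentiableAt ℂ (cauchy μ) z := by
  have h := (hasDerivAt_resolventTransform (A := ℂ) (μ := μ) (a := z) (by
    rintro ⟨x, -, hx⟩
    rw [← hx] at hz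
    simp at hz)).differentiableAt
  have e : cauchy μ = fun w => - resolventTransform μ w := by
    funext w
    rw [cauchy, resolventTransform_apply, ← integral_neg]
    refine integral_congr_ae (ae_of_all _ fun u => ?_)
    simp only [resolvent, Ring.inverse_eq_inv']
    rw [← inv_neg, neg_sub]; rfl
  rw [e]
  exact h.neg

lemma contour_int {f : ℂ → ℂ} {ε C : ℝ} (hε : 0 < ε)
    (hf : ∀ z : ℂ, 0 < z.im → DifferentiableAt ℂ f z)
    (hb : ∀ z : ℂ, ε ≤ z.im → ‖f z‖ ≤ C / (1 + ‖z‖ ^ 2)) (hC : 0 ≤ C) :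
    Integrable (fun x : ℝ => f (x + ε * I)) := by
  refine Integrable.mono' (g := fun x : ℝ => C * (1 + x ^ 2)⁻¹)
    (integrable_inv_one_add_sq.const_mul C) ?_ ?_
  · refine Continuous.aestronglyMeasurable ?_
    rw [continuous_iff_continuousAt]
    intro x
    have h1 : ContinuousAt f ((x : ℂ) + ε * I) := (hf _ (by simpa using hε)).continuousAt
    exact ContinuousAt.comp (f := fun x : ℝ => (x : ℂ) + ε * I) h1 (by fun_prop)
  · refine ae_of_all _ fun x => ?_
    refine (hb _ (by simp)).trans ?_
    rw [div_eq_mul_inv]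
    have h2 : |x| ≤ ‖(x : ℂ) + ε * I‖ := by
      simpa using Complex.abs_re_le_norm ((x : ℂ) + ε * I)
    have : x ^ 2 ≤ ‖(x : ℂ) + ε * I‖ ^ 2 := by
      rw [← sq_abs]; gcongr
    gcongr

lemma contour {f : ℂ → ℂ} {ε C : ℝ} (hε : 0 < ε)
    (hf : ∀ z : ℂ, 0 < z.im → DifferentiableAt ℂ f z)
    (hb : ∀ z : ℂ, ε ≤ z.im → ‖f z‖ ≤ C / (1 + ‖z‖ ^ 2)) (hC : 0 ≤ C) :
    ∫ x : ℝ, f (x + ε * I) = 0 := by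
  have hint := contour_int hε hf hb hC
  have hlim := intervalIntegral_tendsto_integral hint tendsto_neg_atTop_atBot tendsto_id
  have h0 : Tendsto (fun R : ℝ => ∫ x in (-R)..(id R), f (x + ε * I)) atTop (𝓝 0) := by
    refine squeeze_zero_norm' (a := fun R : ℝ => 4 * C / R) ?_ ?_
    · filter_upwards [eventually_gt_atTop 0] with R hR
      have H := integral_boundary_rect_eq_zero_of_differentiableOn f
        (⟨-R, ε⟩ : ℂ) (⟨R, ε + R⟩ : ℂ) (fun z hz => by
          refine (hf z ?_).differentiableWithinAt
          have := hz.2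
          simp only [mem_preimage] at this
          rw [uIcc_of_le (by linarith)] at this
          linarith [this.1])
      simp only at H
      have key : ∀ z : ℂ, ε ≤ z.im → R ≤ ‖z‖ → ‖f z‖ ≤ C / R ^ 2 := by
        intro z h1 h2
        refine (hb z h1).trans ?_
        gcongr
        nlinarith
      have b1 : ‖∫ x : ℝ in (-R)..R, f (x + ((ε + R : ℝ) : ℂ) * I)‖ ≤ C / R ^ 2 * |R - -R| := by
        refine intervalIntegral.norm_integral_le_of_norm_le_const fun x _ => ?_
        refine key _ ?_ ?_
        · simp; exact hR.le
        · have := Complex.abs_im_le_norm ((x : ℂ) + ((ε + R : ℝ) : ℂ) * I)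
          simp only [add_im, ofReal_im, mul_im, I_im, I_re, ofReal_re, mul_one, mul_zero,
            zero_add, add_zero] at this
          exact le_trans (by linarith [le_abs_self (ε + R)]) this
      have b2 : ∀ s : ℝ, |s| = R → ‖∫ y : ℝ in ε..(ε + R), f ((s : ℂ) + y * I)‖ ≤
          C / R ^ 2 * |ε + R - ε| := by
        intro s hs
        refine intervalIntegral.norm_integral_le_of_norm_le_const fun y hy => ?_
        rw [uIoc_of_le (by linarith)] at hy
        refine key _ ?_ ?_
        · simp; exact hy.1.le
        · have := Complex.abs_re_le_norm ((s : ℂ) + y * I)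
          simp at this
          rwa [hs] at this
      have b3 := b2 R (abs_of_pos hR)
      have b4 := b2 (-R) (by rw [abs_neg, abs_of_pos hR])
      have e : (∫ x in (-R)..(id R), f (x + ε * I)) =
          (∫ x : ℝ in (-R)..R, f (x + ((ε + R : ℝ) : ℂ) * I))
          - I • (∫ y : ℝ in ε..(ε + R), f ((R : ℂ) + y * I))
          + I • (∫ y : ℝ in ε..(ε + R), f (((-R : ℝ) : ℂ) + y * I)) := by
        simp only [id]
        linear_combination H
      rw [e]
      refine (norm_add_le _ _).trans ?_
      have := norm_sub_le (∫ x : ℝ in (-R)..R, f (x + ((ε + R : ℝ) : ℂ) * I))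
        (I • (∫ y : ℝ in ε..(ε + R), f ((R : ℂ) + y * I)))
      rw [norm_smul, norm_I, one_mul] at this ⊢
      rw [show R - -R = 2 * R by ring, abs_of_pos (by linarith)] at b1
      rw [show ε + R - ε = R by ring, abs_of_pos hR] at b3 b4
      have : 4 * C / R = C / R ^ 2 * (2 * R) + C / R ^ 2 * R + C / R ^ 2 * R := by
        field_simp; ring
      linarith
    · exact tendsto_const_nhds.div_atTop tendsto_id
  exact tendsto_nhds_unique hlim h0

section ptbound
variable {C c0 a N ε κ : ℝ} {z T k G : ℂ}

lemma Pt.G_le (h : Pt C c0 a N z T k G κ) (hc0 : 0 < c0) (hN2 : 2 ≤ N) (hN4 : 4 / c0 ≤ N) :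
    ‖G‖ ≤ (6 / c0 + 1) * (1 + ‖z‖)⁻¹ ∧ ‖T‖⁻¹ ≤ (6 / c0 + 1) * (1 + ‖z‖)⁻¹ := by
  have h1 := h.T_close (by linarith)
  have h2 := h.F_close (by linarith)
  have e1 : 2 / N ≤ c0 / 2 := by
    rw [div_le_iff₀ hc0] at hN4
    rw [div_le_div_iff₀ (by linarith) (by norm_num)]; linarith
  have h3 := abs_le.1 h2
  have hc := h.hc
  have hGp : 0 < ‖G‖ := norm_pos_iff.2 h.hG
  have hs : 0 < 1 + ‖z‖ := by positivity
  have key : ∀ t : ℝ, c0 / 2 ≤ t → ‖z‖ ≤ t + 2 → t⁻¹ ≤ (6 / c0 + 1) * (1 + ‖z‖)⁻¹ := by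
    intro t ht hzt
    have ht0 : 0 < t := by linarith
    rw [inv_eq_one_div, ← div_eq_mul_inv, div_le_div_iff₀ ht0 hs]
    have : 3 ≤ 6 / c0 * t := by
      rw [div_mul_eq_mul_div, le_div_iff₀ hc0]; linarith
    linarith
  constructor
  · have hz : ‖z‖ ≤ ‖G‖⁻¹ + 2 := by
      rw [h.hz1, ← norm_inv]
      exact (norm_add_le _ _).trans (by linarith [h.hk])
    have := key ‖G‖⁻¹ (by linarith) hz
    rwa [inv_inv] at this
  · refine key _ (by linarith) ?_
    have := norm_sub_norm_le z T
    rw [norm_sub_rev] at this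
    linarith

lemma Pt.D_le (h : Pt C c0 a N z T k G κ) (hC : 0 ≤ C) (hc0 : 0 < c0) (hN2 : 2 ≤ N)
    (hN4 : 4 / c0 ≤ N) (hε : 0 < ε) (hv : ε ≤ T.im) :
    ‖k - G‖ ≤ (|a| + C / N * (1 + 1 / (N ^ 2 * ε)) + 2) * (6 / c0 + 1) ^ 2 * (1 + ‖z‖)⁻¹ ^ 2 := by
  obtain ⟨hG, hT⟩ := h.G_le hc0 hN2 hN4
  have hT0 : T ≠ 0 := fun h0 => by have := h.hT; rw [h0] at this; simp at this
  have hN0 : (N : ℂ) ≠ 0 := by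
    exact_mod_cast (show N ≠ 0 by linarith)
  set q := (6 / c0 + 1) * (1 + ‖z‖)⁻¹ with hq
  have hTn : 0 < ‖T‖ := norm_pos_iff.2 hT0
  have e : k - G = (k - 1 / T - a / T ^ 2) + a * T⁻¹ ^ 2 - G * T⁻¹ * (k / N) := by
    have := h.F_eq
    have e2 : k / N = T - G⁻¹ := by rw [this]; ring
    rw [e2]
    have := h.hG
    field_simp
    ring
  rw [e]
  have n1 := h.hke
  have n1' : ‖k - 1 / T - a / T ^ 2‖ ≤ C / N * (1 + 1 / (N ^ 2 * ε)) * q ^ 2 := by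
    refine n1.trans ?_
    rw [div_eq_mul_inv _ (‖T‖ ^ 2), ← inv_pow]
    gcongr
  have n2 : ‖(a : ℂ) * T⁻¹ ^ 2‖ ≤ |a| * q ^ 2 := by
    rw [norm_mul, norm_pow, norm_inv, Complex.norm_real, Real.norm_eq_abs]
    gcongr
  have n3 : ‖G * T⁻¹ * (k / N)‖ ≤ q * q * 2 := by
    rw [norm_mul, norm_mul, norm_inv]
    have : ‖k / (N : ℂ)‖ ≤ 2 := by
      rw [norm_div, Complex.norm_real, Real.norm_of_nonneg (by linarith),
        div_le_iff₀ (by linarith)]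
      linarith [h.hk]
    gcongr
  refine (norm_sub_le _ _).trans ?_
  have := norm_add_le (k - 1 / T - a / T ^ 2) ((a : ℂ) * T⁻¹ ^ 2)
  have e3 : (|a| + C / N * (1 + 1 / (N ^ 2 * ε)) + 2) * (6 / c0 + 1) ^ 2 * (1 + ‖z‖)⁻¹ ^ 2
    = C / N * (1 + 1 / (N ^ 2 * ε)) * q ^ 2 + |a| * q ^ 2 + q * q * 2 := by rw [hq]; ring
  rw [e3]
  linarith

lemma Pt.im_le (h : Pt C c0 a N z T k G κ) (hN : 1 ≤ N) : z.im ≤ T.im := by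
  have hz : z = ((z.re : ℝ) : ℂ) + (z.im : ℝ) * I := (Complex.re_add_im z).symm
  have h' := h
  rw [hz] at h'
  have := h'.v_eq
  have h1 : 1 / N ≤ 1 := by rw [div_le_one (by linarith)]; exact hN
  have : 0 ≤ (1 - 1 / N) * κ * T.im :=
    mul_nonneg (mul_nonneg (by linarith) h.hκ0) h.hT.le
  linarith

lemma Pt.f_le (h : Pt C c0 a N z T k G κ) (hC : 0 ≤ C) (hc0 : 0 < c0) (hN2 : 2 ≤ N)
    (hN4 : 4 / c0 ≤ N) (hε : 0 < ε) (hv : ε ≤ z.im) {K1 K2 : ℝ} (hK1 : K1 = 6 / c0 + 1)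
    (hK2 : K2 = (|a| + C / N * (1 + 1 / (N ^ 2 * ε)) + 2) * (6 / c0 + 1) ^ 2) :
    ‖LL a k G + (1 + (a : ℂ) ^ 2) * (z + I)⁻¹‖ ≤
      (K2 + K1 * K2 ^ 2 + K1 ^ 3 + a ^ 2 * (K1 ^ 3 + K1 ^ 5) + (1 + a ^ 2) * (K1 * 3 * 3)) /
        (1 + ‖z‖ ^ 2) := by
  obtain ⟨hG, -⟩ := h.G_le hc0 hN2 hN4
  have hD := h.D_le hC hc0 hN2 hN4 hε (hv.trans (h.im_le (by linarith)))
  rw [← hK1] at hG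
  rw [← hK2] at hD
  have hzi : 1 ≤ ‖z + I‖ := by
    have := Complex.abs_im_le_norm (z + I)
    simp only [add_im, I_im] at this
    linarith [le_abs_self (z.im + 1)]
  have hzi0 : z + I ≠ 0 := norm_pos_iff.1 (by linarith)
  have hs : 0 < 1 + ‖z‖ := by positivity
  have hW : ‖(z + I)⁻¹‖ ≤ 3 * (1 + ‖z‖)⁻¹ := by
    rw [norm_inv, inv_eq_one_div, ← div_eq_mul_inv, div_le_div_iff₀ (by linarith) hs]
    have := norm_sub_le (z + I) I
    rw [add_sub_cancel_right, norm_I] at this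
    linarith
  have hq1 : (1 + ‖z‖)⁻¹ ≤ 1 := inv_le_one_of_one_le₀ (by linarith [norm_nonneg z])
  have hqq : (1 + ‖z‖)⁻¹ ^ 2 ≤ (1 + ‖z‖ ^ 2)⁻¹ := by
    rw [inv_pow]
    refine inv_anti₀ (by positivity) ?_
    nlinarith [norm_nonneg z]
  have hq0 : 0 < (1 + ‖z‖)⁻¹ := by positivity
  set q := (1 + ‖z‖)⁻¹ with hq
  have hK10 : 0 ≤ K1 := by rw [hK1]; positivity
  have hK20 : 0 ≤ K2 := by rw [hK2]; have : 0 < N := by linarith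
                           positivity
  have e : LL a k G + (1 + (a : ℂ) ^ 2) * (z + I)⁻¹ =
      (k - G) + G * (k - G) ^ 2 + G ^ 3 / 3 - ((a ^ 2 : ℝ) : ℂ) * (G ^ 3 + G ^ 5)
        - ((1 + a ^ 2 : ℝ) : ℂ) * (G * (z + I)⁻¹ * (k + I)) := by
    have e1 : G * (z + I)⁻¹ * (k + I) = G - (z + I)⁻¹ := by
      have : k = z - G⁻¹ := by rw [h.hz1]; ring
      have hG0 := h.hG
      rw [this]; field_simp; ring
    rw [e1, LL]
    push_cast
    ring
  rw [e]
  have n2 : ‖G * (k - G) ^ 2‖ ≤ K1 * K2 ^ 2 * q ^ 2 := by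
    rw [norm_mul, norm_pow]
    calc ‖G‖ * ‖k - G‖ ^ 2 ≤ K1 * q * (K2 * q ^ 2) ^ 2 := by gcongr
      _ = K1 * K2 ^ 2 * q ^ 2 * q ^ 3 := by ring
      _ ≤ K1 * K2 ^ 2 * q ^ 2 * 1 := by gcongr; exact pow_le_one₀ hq0.le hq1
      _ = _ := by ring
  have n3' : ‖G‖ ^ 3 ≤ K1 ^ 3 * q ^ 2 := by
    calc ‖G‖ ^ 3 ≤ (K1 * q) ^ 3 := by gcongr
      _ = K1 ^ 3 * q ^ 2 * q := by ring
      _ ≤ K1 ^ 3 * q ^ 2 * 1 := by gcongr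
      _ = _ := by ring
  have n5' : ‖G‖ ^ 5 ≤ K1 ^ 5 * q ^ 2 := by
    calc ‖G‖ ^ 5 ≤ (K1 * q) ^ 5 := by gcongr
      _ = K1 ^ 5 * q ^ 2 * q ^ 3 := by ring
      _ ≤ K1 ^ 5 * q ^ 2 * 1 := by gcongr; exact pow_le_one₀ hq0.le hq1
      _ = _ := by ring
  have n3 : ‖G ^ 3 / 3‖ ≤ K1 ^ 3 * q ^ 2 := by
    rw [norm_div, norm_pow]
    have : ‖(3 : ℂ)‖ = 3 := by norm_num
    rw [this]
    have : 0 ≤ ‖G‖ ^ 3 := by positivity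
    linarith
  have n4 : ‖((a ^ 2 : ℝ) : ℂ) * (G ^ 3 + G ^ 5)‖ ≤ a ^ 2 * (K1 ^ 3 + K1 ^ 5) * q ^ 2 := by
    rw [norm_mul, Complex.norm_real, Real.norm_of_nonneg (sq_nonneg a), mul_assoc]
    gcongr
    refine (norm_add_le _ _).trans ?_
    rw [norm_pow, norm_pow]; linarith
  have n5 : ‖((1 + a ^ 2 : ℝ) : ℂ) * (G * (z + I)⁻¹ * (k + I))‖ ≤
      (1 + a ^ 2) * (K1 * 3 * 3) * q ^ 2 := by
    rw [norm_mul, Complex.norm_real, Real.norm_of_nonneg (by positivity), mul_assoc (1 + a ^ 2)]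
    gcongr
    have hk : ‖k + I‖ ≤ 3 := by
      refine (norm_add_le _ _).trans ?_
      rw [norm_I]; linarith [h.hk]
    rw [norm_mul, norm_mul]
    calc ‖G‖ * ‖(z + I)⁻¹‖ * ‖k + I‖ ≤ (K1 * q) * (3 * q) * 3 := by gcongr
      _ = _ := by ring
  have t1 := norm_add_le (k - G) (G * (k - G) ^ 2)
  have t2 := norm_add_le (k - G + G * (k - G) ^ 2) (G ^ 3 / 3)
  have t3 := norm_sub_le (k - G + G * (k - G) ^ 2 + G ^ 3 / 3)
    (((a ^ 2 : ℝ) : ℂ) * (G ^ 3 + G ^ 5))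
  refine (norm_sub_le _ _).trans ?_
  rw [div_eq_mul_inv _ (1 + ‖z‖ ^ 2)]
  calc _ ≤ (K2 + K1 * K2 ^ 2 + K1 ^ 3 + a ^ 2 * (K1 ^ 3 + K1 ^ 5) + (1 + a ^ 2) * (K1 * 3 * 3))
          * q ^ 2 := by linarith
    _ ≤ _ := by gcongr

end ptbound

lemma poisson_int {b : ℝ} (hb : 0 < b) :
    Integrable (fun x : ℝ => ((x + b * I : ℂ)⁻¹).im) ∧
      ∫ x : ℝ, ((x + b * I : ℂ)⁻¹).im = - Real.pi := by
  have e : (fun x : ℝ => ((x + b * I : ℂ)⁻¹).im) = fun x : ℝ => (-b⁻¹) * (1 + (x / b) ^ 2)⁻¹ := by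
    funext x
    rw [Complex.inv_im, Complex.normSq_apply]
    simp only [add_im, ofReal_im, mul_im, I_im, I_re, ofReal_re, mul_one, mul_zero,
            zero_add, add_zero, add_re, mul_re, sub_zero]
    have : 0 < x * x + b * b := by nlinarith [mul_pos hb hb, mul_self_nonneg x]
    field_simp
    ring
  rw [e]
  constructor
  · exact (integrable_inv_one_add_sq.comp_div hb.ne').const_mul _
  · rw [integral_const_mul, Measure.integral_comp_div (fun y : ℝ => (1 + y ^ 2)⁻¹) b,
      integral_univ_inv_one_add_sq, abs_of_pos hb, smul_eq_mul]
    field_simp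

/-- hypothesis bundle -/
def AllPt (C c0 a N : ℝ) (ρ : Measure ℝ) : Prop :=
  ∀ z : ℂ, 0 < z.im → ∃ T k κ, Pt C c0 a N z T k (cauchy ρ z) κ

def K8 (ρ : Measure ℝ) (z : ℂ) : ℂ := z - (cauchy ρ z)⁻¹

section main
variable {C c0 a N : ℝ} {ρ : Measure ℝ} [IsProbabilityMeasure ρ]

lemma AllPt.get (h : AllPt C c0 a N ρ) {z : ℂ} (hz : 0 < z.im) :
    ∃ T κ, Pt C c0 a N z T (K8 ρ z) (cauchy ρ z) κ := by
  obtain ⟨T, k, κ, hP⟩ := h z hz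
  have : k = K8 ρ z := by
    have := hP.hz1
    rw [K8]
    linear_combination -this
  exact ⟨T, κ, this ▸ hP⟩

lemma int_LL (h : AllPt C c0 a N ρ) (hC : 0 ≤ C) (hc0 : 0 < c0) (hN2 : 2 ≤ N)
    (hN4 : 4 / c0 ≤ N) {ε : ℝ} (hε : 0 < ε) :
    Integrable (fun x : ℝ => (LL a (K8 ρ (x + ε * I)) (cauchy ρ (x + ε * I))).im) ∧
    ∫ x : ℝ, (LL a (K8 ρ (x + ε * I)) (cauchy ρ (x + ε * I))).im = Real.pi * (1 + a ^ 2) := by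
  set f : ℂ → ℂ := fun z => LL a (K8 ρ z) (cauchy ρ z) + (1 + (a : ℂ) ^ 2) * (z + I)⁻¹ with hf
  have hd : ∀ z : ℂ, 0 < z.im → DifferentiableAt ℂ f z := by
    intro z hz
    have d1 := cauchy_diff ρ hz
    have d2 : DifferentiableAt ℂ (K8 ρ) z := differentiableAt_id.sub (d1.inv (cauchy_ne ρ hz))
    have hzi : z + I ≠ 0 := fun h0 => by
      have := congrArg Complex.im h0
      simp at this; linarith
    have d3 : DifferentiableAt ℂ (fun z : ℂ => (z + I)⁻¹) z :=
      (differentiableAt_id.add_const I).inv hzi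
    simp only [hf, LL]
    fun_prop
  have hN0 : 0 < N := by linarith
  have hb : ∀ z : ℂ, ε ≤ z.im → ‖f z‖ ≤ _ / (1 + ‖z‖ ^ 2) := fun z hz => by
    obtain ⟨T, κ, hP⟩ := h.get (hε.trans_le hz)
    exact hP.f_le hC hc0 hN2 hN4 hε hz rfl rfl
  have hi := contour_int hε hd hb (by positivity)
  have h0 := contour hε hd hb (by positivity)
  have hi' : Integrable (fun x : ℝ => (f (x + ε * I)).im) := hi.im
  have h0' : ∫ x : ℝ, (f (x + ε * I)).im = 0 := by
    have := integral_im hi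
    simp only [RCLike.im_eq_complex_im] at this
    rw [this, h0]; simp
  obtain ⟨p1, p2⟩ := poisson_int (b := 1 + ε) (by linarith)
  have e : (fun x : ℝ => (LL a (K8 ρ (x + ε * I)) (cauchy ρ (x + ε * I))).im) =
      fun x : ℝ => (f (x + ε * I)).im - (1 + a ^ 2) * ((x + (1 + ε : ℝ) * I : ℂ)⁻¹).im := by
    funext x
    simp only [hf, add_im]
    rw [show (1 + (a : ℂ) ^ 2) = ((1 + a ^ 2 : ℝ) : ℂ) by push_cast; rfl, Complex.im_ofReal_mul]
    rw [show (x : ℂ) + ε * I + I = x + (1 + ε : ℝ) * I by push_cast; ring]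
    ring
  rw [e]
  refine ⟨hi'.sub (p1.const_mul _), ?_⟩
  rw [integral_sub hi' (p1.const_mul _), integral_const_mul, p2, h0']
  ring

lemma B_cont {ε : ℝ} (hε : 0 < ε) : Continuous (fun x : ℝ => (cauchy ρ (x + ε * I)).im) := by
  refine Complex.continuous_im.comp ?_
  rw [continuous_iff_continuousAt]
  intro x
  have h1 : ContinuousAt (cauchy ρ) ((x : ℂ) + ε * I) :=
    (cauchy_diff ρ (by simpa using hε)).continuousAt
  exact ContinuousAt.comp (f := fun x : ℝ => (x : ℂ) + ε * I) h1 (by fun_prop)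

lemma B_le (h : AllPt C c0 a N ρ) (hc0 : 0 < c0) (hN2 : 2 ≤ N)
    (hN4 : 4 / c0 ≤ N) {ε : ℝ} (hε : 0 < ε) (x : ℝ) :
    ‖(- (cauchy ρ (x + ε * I)).im) ^ 3‖ ≤ (6 / c0 + 1) ^ 3 * (1 + x ^ 2)⁻¹ := by
  obtain ⟨T, κ, hP⟩ := h.get (z := x + ε * I) (by simpa using hε)
  have h1 := (hP.G_le hc0 hN2 hN4).1
  have h2 : |x| ≤ ‖(x : ℂ) + ε * I‖ := by
    simpa using Complex.abs_re_le_norm ((x : ℂ) + ε * I)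
  have h3 : (1 + ‖(x : ℂ) + ε * I‖)⁻¹ ≤ (1 + |x|)⁻¹ := by gcongr
  have h4 : (1 + |x|)⁻¹ ≤ 1 := inv_le_one_of_one_le₀ (by linarith [abs_nonneg x])
  have h5 : (1 + |x|)⁻¹ ^ 2 ≤ (1 + x ^ 2)⁻¹ := by
    rw [inv_pow]
    refine inv_anti₀ (by positivity) ?_
    nlinarith [abs_nonneg x, sq_abs x]
  rw [norm_pow, norm_neg, Real.norm_eq_abs]
  have h6 := Complex.abs_im_le_norm (cauchy ρ (x + ε * I))
  calc |(cauchy ρ (x + ε * I)).im| ^ 3 ≤ ((6 / c0 + 1) * (1 + |x|)⁻¹) ^ 3 := by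
        gcongr
        exact h6.trans (h1.trans (by gcongr))
    _ = (6 / c0 + 1) ^ 3 * ((1 + |x|)⁻¹ ^ 2 * (1 + |x|)⁻¹) := by ring
    _ ≤ (6 / c0 + 1) ^ 3 * ((1 + x ^ 2)⁻¹ * 1) := by gcongr
    _ = _ := by ring

lemma B_int (h : AllPt C c0 a N ρ) (hc0 : 0 < c0) (hN2 : 2 ≤ N)
    (hN4 : 4 / c0 ≤ N) {ε : ℝ} (hε : 0 < ε) :
    Integrable (fun x : ℝ => (- (cauchy ρ (x + ε * I)).im) ^ 3) :=
  Integrable.mono' (integrable_inv_one_add_sq.const_mul ((6 / c0 + 1) ^ 3))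
    ((B_cont hε).neg.pow 3).aestronglyMeasurable
    (ae_of_all _ fun x => B_le h hc0 hN2 hN4 hε x)

lemma eps_bound (h : AllPt C c0 a N ρ) (hC : 0 ≤ C) (hc0 : 0 < c0) (hN2 : 2 ≤ N)
    (hN4 : 4 / c0 ≤ N) {ε M : ℝ} (hε : 0 < ε)
    (hM : ∀ (x κ : ℝ) (T k G : ℂ), Pt C c0 a N (x + ε * I) T k G κ →
      |(4 / 3) * (- G.im) ^ 3 - (LL a k G).im| ≤ M * (1 + x ^ 2)⁻¹) :
    |(4 / 3) * (∫ x : ℝ, (- (cauchy ρ (x + ε * I)).im) ^ 3) - Real.pi * (1 + a ^ 2)| ≤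
      M * Real.pi := by
  obtain ⟨l1, l2⟩ := int_LL h hC hc0 hN2 hN4 hε
  have b1 := B_int h hc0 hN2 hN4 hε
  rw [← l2, ← integral_const_mul, ← integral_sub (b1.const_mul _) l1,
    ← integral_univ_inv_one_add_sq, ← integral_const_mul, ← Real.norm_eq_abs]
  refine norm_integral_le_of_norm_le (integrable_inv_one_add_sq.const_mul M)
    (ae_of_all _ fun x => ?_)
  obtain ⟨T, κ, hP⟩ := h.get (z := x + ε * I) (by simpa using hε)
  exact hM x κ T _ _ hP

lemma p_integrable {p : ℝ → ℝ} (hd : HasDensity ρ p) : Integrable p := by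
  obtain ⟨pc, p0, hr⟩ := hd
  refine ⟨pc.aestronglyMeasurable, ?_⟩
  rw [hasFiniteIntegral_iff_ofReal (ae_of_all _ p0)]
  have : ρ univ = 1 := measure_univ
  rw [hr, withDensity_apply _ MeasurableSet.univ, setLIntegral_univ] at this
  rw [this]; simp

lemma G_poisson {p : ℝ → ℝ} (hd : HasDensity ρ p) {c : ℝ} (hc : 0 < c) (x : ℝ) :
    ∫ u : ℝ, (c ^ (Module.finrank ℝ ℝ) * (Real.pi⁻¹ * (1 + (c • (x - u)) ^ 2)⁻¹)) • p u =
      Real.pi⁻¹ * (- (cauchy ρ (x + (c⁻¹ : ℝ) * I)).im) := by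
  obtain ⟨pc, p0, hr⟩ := hd
  have hz : 0 < ((x : ℂ) + (c⁻¹ : ℝ) * I).im := by simpa using hc
  have e1 : (cauchy ρ (x + (c⁻¹ : ℝ) * I)).im =
      ∫ u, (((x : ℂ) + (c⁻¹ : ℝ) * I - u)⁻¹).im ∂ρ := by
    have := integral_im (X_int ρ hz)
    simp only [RCLike.im_eq_complex_im] at this
    rw [this]; rfl
  rw [e1, ← integral_neg, ← integral_const_mul, hr,
    integral_withDensity_eq_integral_toReal_smul (by fun_prop) (by simp)]
  refine integral_congr_ae (ae_of_all _ fun u => ?_)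
  simp only
  rw [ENNReal.toReal_ofReal (p0 u), Complex.inv_im, Complex.normSq_apply]
  simp only [add_im, ofReal_im, mul_im, I_im, I_re, ofReal_re, mul_one, mul_zero,
            zero_add, add_zero, add_re, mul_re, sub_zero, sub_im, sub_re, smul_eq_mul,
            Module.finrank_self, pow_one]
  have h1 : 0 < (x - u) * (x - u) + c⁻¹ * c⁻¹ := by
    have := inv_pos.2 hc
    nlinarith [mul_pos this this, mul_self_nonneg (x - u)]
  have h2 : 0 < 1 + (c * (x - u)) ^ 2 := by positivity
  have h3 : (x - u) * (x - u) + c⁻¹ * c⁻¹ = (1 + (c * (x - u)) ^ 2) / c ^ 2 := by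
    field_simp; ring
  rw [h3]
  field_simp

lemma B_lim {p : ℝ → ℝ} (hd : HasDensity ρ p) (x : ℝ) :
    Tendsto (fun c : ℝ => - (cauchy ρ (x + (c⁻¹ : ℝ) * I)).im) atTop (𝓝 (Real.pi * p x)) := by
  have h := tendsto_integral_comp_smul_smul_of_integrable' (μ := (volume : Measure ℝ))
    (φ := fun t : ℝ => Real.pi⁻¹ * (1 + t ^ 2)⁻¹)
    (fun t => by positivity) (by
      rw [integral_const_mul, integral_univ_inv_one_add_sq]
      exact inv_mul_cancel₀ Real.pi_ne_zero) (by
      simp only [Module.finrank_self, pow_one]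
      have hb : Tendsto (fun t : ℝ => ‖t‖⁻¹) (Bornology.cobounded ℝ) (𝓝 0) :=
        tendsto_inv_atTop_zero.comp tendsto_norm_cobounded_atTop
      refine squeeze_zero_norm (fun t => ?_) hb
      rw [Real.norm_of_nonneg (by positivity)]
      have hpi : Real.pi⁻¹ ≤ 1 := inv_le_one_of_one_le₀ (by linarith [Real.pi_gt_three])
      rcases eq_or_ne t 0 with rfl | ht
      · simp
      have ht' : 0 < ‖t‖ := norm_pos_iff.2 ht
      calc ‖t‖ * (Real.pi⁻¹ * (1 + t ^ 2)⁻¹) ≤ ‖t‖ * (1 * (‖t‖ ^ 2)⁻¹) := by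
            gcongr
            rw [Real.norm_eq_abs, sq_abs]; linarith
        _ = ‖t‖⁻¹ := by field_simp)
    (p_integrable hd) (x₀ := x) hd.1.continuousAt
  have h' := h.const_mul Real.pi
  refine h'.congr' ?_
  filter_upwards [eventually_gt_atTop 0] with c hc
  rw [G_poisson hd hc x, mul_inv_cancel_left₀ Real.pi_ne_zero]

lemma int_lim {p : ℝ → ℝ} (hd : HasDensity ρ p) (h : AllPt C c0 a N ρ) (hc0 : 0 < c0)
    (hN2 : 2 ≤ N) (hN4 : 4 / c0 ≤ N) :
    Tendsto (fun c : ℝ => ∫ x : ℝ, (- (cauchy ρ (x + (c⁻¹ : ℝ) * I)).im) ^ 3) atTop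
      (𝓝 (∫ x : ℝ, (Real.pi * p x) ^ 3)) := by
  refine tendsto_integral_filter_of_dominated_convergence
    (fun x => (6 / c0 + 1) ^ 3 * (1 + x ^ 2)⁻¹) ?_ ?_
    (integrable_inv_one_add_sq.const_mul _) ?_
  · filter_upwards [eventually_gt_atTop 0] with c hc
    exact (B_int h hc0 hN2 hN4 (inv_pos.2 hc)).aestronglyMeasurable
  · filter_upwards [eventually_gt_atTop 0] with c hc
    exact ae_of_all _ fun x => B_le h hc0 hN2 hN4 (inv_pos.2 hc) x
  · exact ae_of_all _ fun x => (B_lim hd x).pow 3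

lemma final_bound {p : ℝ → ℝ} (hd : HasDensity ρ p) (h : AllPt C c0 a N ρ) (hC : 0 ≤ C)
    (hc0 : 0 < c0) (hN2 : 2 ≤ N) (hN4 : 4 / c0 ≤ N) {M ε0 : ℝ} (hε0 : 0 < ε0)
    (hM : ∀ (ε x κ : ℝ) (T k G : ℂ), 0 < ε → ε ≤ ε0 → Pt C c0 a N (x + ε * I) T k G κ →
      |(4 / 3) * (- G.im) ^ 3 - (LL a k G).im| ≤ M * (1 + x ^ 2)⁻¹) :
    |(4 * Real.pi ^ 2 / 3) * (∫ x : ℝ, (p x) ^ 3) - (1 + a ^ 2)| ≤ M := by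
  have hl := (((int_lim hd h hc0 hN2 hN4).const_mul (4 / 3)).sub_const
    (Real.pi * (1 + a ^ 2))).abs
  have hb : |4 / 3 * (∫ x : ℝ, (Real.pi * p x) ^ 3) - Real.pi * (1 + a ^ 2)| ≤ M * Real.pi := by
    refine le_of_tendsto hl ?_
    filter_upwards [eventually_ge_atTop ε0⁻¹, eventually_gt_atTop 0] with c hc hc0'
    refine eps_bound h hC hc0 hN2 hN4 (inv_pos.2 hc0') fun x κ T k G hP =>
      hM _ x κ T k G (inv_pos.2 hc0') ?_ hP
    exact inv_le_of_inv_le₀ hε0 hc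
  simp only [mul_pow] at hb
  rw [integral_const_mul, show 4 / 3 * (Real.pi ^ 3 * ∫ x : ℝ, p x ^ 3) - Real.pi * (1 + a ^ 2) =
    ((4 * Real.pi ^ 2 / 3) * (∫ x : ℝ, (p x) ^ 3) - (1 + a ^ 2)) * Real.pi by ring, abs_mul,
    abs_of_pos Real.pi_pos] at hb
  exact le_of_mul_le_mul_right hb Real.pi_pos

end main

lemma Cc_nonneg {μ : Measure ℝ} [IsProbabilityMeasure μ] (h8 : Integrable (fun u : ℝ => u ^ 8) μ)
    (h2 : mom μ 2 = 1) : 0 ≤ Cc μ := by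
  have h0 := c0_pos h8 h2
  have m4 : 0 ≤ mom μ 4 := mom_nonneg (by decide)
  have m8 : 0 ≤ mom μ 8 := mom_nonneg (by decide)
  unfold Cc C1c C2c
  positivity

theorem stmt_4
    (μ : Measure ℝ) [IsProbabilityMeasure μ]
    (hnotdirac : ¬ ∃ c : ℝ, μ = Measure.dirac c)
    (h8 : Integrable (fun u => u ^ 8) μ)
    (h1 : mom μ 1 = 0) (h2 : mom μ 2 = 1)
    (Z : ℕ → ℂ → ℂ) (ν : ℕ → Measure ℝ)
    (hbox : ∀ n : ℕ, 1 ≤ n → IsBoxPow μ n (Z n) (ν n))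
    (p : ℕ → ℝ → ℝ)
    (hp : ∀ᶠ n in atTop, HasDensity (rescale n (ν n)) (p n)) :
    ∃ c : ℝ, 0 < c ∧ ∃ n₁ : ℕ, ∀ n : ℕ, n₁ ≤ n →
      |(4 * Real.pi ^ 2 / 3) * (∫ x : ℝ, (p n x) ^ 3) - (1 + (mom μ 3) ^ 2 / (n : ℝ))|
        ≤ c * (n : ℝ) ^ (-(6 / 5 : ℝ)) := by
  have hc0 := c0_pos h8 h2
  have hC := Cc_nonneg h8 h2
  obtain ⟨n0, hn0, hA⟩ := lemmaA h8 h1 h2 Z ν hbox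
  obtain ⟨n2, hn2⟩ := eventually_atTop.1 hp
  obtain ⟨n3, hn3⟩ := exists_nat_ge (4 / c0c μ)
  obtain ⟨C', hC', hpt⟩ := point_all (Cc μ) (c0c μ) (mom μ 3) hC hc0
  refine ⟨C' + 1, by linarith, n0 + n2 + n3, fun n hn => ?_⟩
  have hn2' : 2 ≤ n := by omega
  have hnR : (2 : ℝ) ≤ n := by exact_mod_cast hn2'
  have hnpos : (0 : ℝ) < n := by linarith
  have hn4 : 4 / c0c μ ≤ n := hn3.trans (by exact_mod_cast (by omega : n3 ≤ n))
  have : IsProbabilityMeasure (ν n) := (hbox n (by omega)).2.1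
  have : IsProbabilityMeasure (rescale n (ν n)) :=
    Measure.isProbabilityMeasure_map (by fun_prop)
  set θ : ℝ := (n : ℝ) ^ (-(6 / 5 : ℝ)) with hθ
  have hθ0 : 0 < θ := Real.rpow_pos_of_pos hnpos _
  set h : ℝ := (n : ℝ) ^ (-(1 / 2 : ℝ)) with hh
  have hh0 : 0 < h := Real.rpow_pos_of_pos hnpos _
  have hpow : ∀ m : ℕ, h ^ m = (n : ℝ) ^ (-(1 / 2 : ℝ) * m) := fun m => by
    rw [hh, ← Real.rpow_natCast, ← Real.rpow_mul hnpos.le]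
  have hN : 1 / (n : ℝ) = h ^ 2 := by
    rw [hpow, show (-(1 / 2 : ℝ) * (2 : ℕ)) = -1 by norm_num, Real.rpow_neg_one, one_div]
  have hh1 : h ≤ 1 := Real.rpow_le_one_of_one_le_of_nonpos (by linarith) (by norm_num)
  have hsq : h = 1 / Real.sqrt n := by
    rw [hh, Real.rpow_neg hnpos.le, Real.sqrt_eq_rpow]
    exact (one_div _).symm
  have h5 : h ^ 5 ≤ θ ^ 2 := by
    rw [hpow, hθ, ← Real.rpow_natCast, ← Real.rpow_mul hnpos.le]
    exact Real.rpow_le_rpow_of_exponent_le (by linarith) (by norm_num)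
  have h3 : h ^ 3 ≤ θ := by
    rw [hpow]
    exact Real.rpow_le_rpow_of_exponent_le (by linarith) (by norm_num)
  have ha : mom μ 3 / Real.sqrt n = mom μ 3 * h := by rw [hsq]; ring
  have hall : AllPt (Cc μ) (c0c μ) (mom μ 3 * h) n (rescale n (ν n)) := fun z hz => by
    rw [← ha]; exact hA n (by omega) z hz
  have hfin := final_bound (hn2 n (by omega)) hall hC hc0 hnR hn4 (M := C' * θ) (ε0 := h ^ 8)
    (by positivity) (fun ε x κ T k G e1 e2 hP =>
      hpt n h ε x θ κ T k G hP hN hnR hn4 hh0 hh1 e1 e2 hθ0 h5 h3)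
  rw [mul_pow, ← hN, mul_one_div] at hfin
  refine hfin.trans ?_
  nlinarith

end FreeCLT
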